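/- arXiv:math/0411155 — 3 statements merged into one kernel-verified Lean document; each statement's English description precedes it below -/
import Mathlib

section
/- For n ≥ 2, W_{n,R} is spanned as an R-module by elements of the form a·χ·b, where a and b lie in the subalgebra of W_{n,R} generated by {g_i, g_i⁻¹, e_i : 1 ≤ i ≤ n−2}, and χ ∈ {1, g_{n−1}, g_{n−1}⁻¹, e_{n−1}}. -/
namespace BMW

/-- Generators of the Birman–Wenzl–Murakami algebra `W_{n,R}`:
`g i`, `g i`⁻¹ and `e i` for `1 ≤ i ≤ n - 1`. -/
inductive Gen (n : ℕ) : Type where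
  | g (i : ℕ) (h : 1 ≤ i ∧ i < n) : Gen n
  | gi (i : ℕ) (h : 1 ≤ i ∧ i < n) : Gen n
  | e (i : ℕ) (h : 1 ≤ i ∧ i < n) : Gen n

variable (R : Type*) [CommRing R]

/-- The generator `g i` in the free algebra (junk value `1` if `i` is out of range). -/
noncomputable def FG (n i : ℕ) : FreeAlgebra R (Gen n) :=
  if h : 1 ≤ i ∧ i < n then FreeAlgebra.ι R (Gen.g i h) else 1

/-- The generator `g i⁻¹` in the free algebra (junk value `1` if `i` is out of range). -/
noncomputable def FGi (n i : ℕ) : FreeAlgebra R (Gen n) :=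
  if h : 1 ≤ i ∧ i < n then FreeAlgebra.ι R (Gen.gi i h) else 1

/-- The generator `e i` in the free algebra (junk value `1` if `i` is out of range). -/
noncomputable def FE (n i : ℕ) : FreeAlgebra R (Gen n) :=
  if h : 1 ≤ i ∧ i < n then FreeAlgebra.ι R (Gen.e i h) else 1

/-- The defining relations of the Birman–Wenzl–Murakami algebra `W_{n,R}`. -/
inductive Rel (lam laminv del z : R) (n : ℕ) :
    FreeAlgebra R (Gen n) → FreeAlgebra R (Gen n) → Prop where
  | inv_right (i : ℕ) (h : 1 ≤ i ∧ i < n) :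
      Rel lam laminv del z n (FG R n i * FGi R n i) 1
  | inv_left (i : ℕ) (h : 1 ≤ i ∧ i < n) :
      Rel lam laminv del z n (FGi R n i * FG R n i) 1
  | idem (i : ℕ) (h : 1 ≤ i ∧ i < n) :
      Rel lam laminv del z n (FE R n i * FE R n i) (del • FE R n i)
  | braid (i : ℕ) (h : 1 ≤ i ∧ i + 1 < n) :
      Rel lam laminv del z n (FG R n i * FG R n (i + 1) * FG R n i)
        (FG R n (i + 1) * FG R n i * FG R n (i + 1))
  | comm_gg (i j : ℕ) (h : 1 ≤ i ∧ 1 ≤ j ∧ i < n ∧ j < n ∧ (i + 2 ≤ j ∨ j + 2 ≤ i)) :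
      Rel lam laminv del z n (FG R n i * FG R n j) (FG R n j * FG R n i)
  | comm_ge (i j : ℕ) (h : 1 ≤ i ∧ 1 ≤ j ∧ i < n ∧ j < n ∧ (i + 2 ≤ j ∨ j + 2 ≤ i)) :
      Rel lam laminv del z n (FG R n i * FE R n j) (FE R n j * FG R n i)
  | comm_ee (i j : ℕ) (h : 1 ≤ i ∧ 1 ≤ j ∧ i < n ∧ j < n ∧ (i + 2 ≤ j ∨ j + 2 ≤ i)) :
      Rel lam laminv del z n (FE R n i * FE R n j) (FE R n j * FE R n i)
  | tangle_eee_up (i : ℕ) (h : 1 ≤ i ∧ i + 1 < n) :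
      Rel lam laminv del z n (FE R n i * FE R n (i + 1) * FE R n i) (FE R n i)
  | tangle_eee_down (i : ℕ) (h : 1 ≤ i ∧ i + 1 < n) :
      Rel lam laminv del z n (FE R n (i + 1) * FE R n i * FE R n (i + 1)) (FE R n (i + 1))
  | tangle_gge_up (i : ℕ) (h : 1 ≤ i ∧ i + 1 < n) :
      Rel lam laminv del z n (FG R n i * FG R n (i + 1) * FE R n i)
        (FE R n (i + 1) * FE R n i)
  | tangle_gge_down (i : ℕ) (h : 1 ≤ i ∧ i + 1 < n) :
      Rel lam laminv del z n (FG R n (i + 1) * FG R n i * FE R n (i + 1))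
        (FE R n i * FE R n (i + 1))
  | tangle_egg_up (i : ℕ) (h : 1 ≤ i ∧ i + 1 < n) :
      Rel lam laminv del z n (FE R n i * FG R n (i + 1) * FG R n i)
        (FE R n i * FE R n (i + 1))
  | tangle_egg_down (i : ℕ) (h : 1 ≤ i ∧ i + 1 < n) :
      Rel lam laminv del z n (FE R n (i + 1) * FG R n i * FG R n (i + 1))
        (FE R n (i + 1) * FE R n i)
  | skein (i : ℕ) (h : 1 ≤ i ∧ i < n) :
      Rel lam laminv del z n (FG R n i - FGi R n i) (z • (FE R n i - 1))
  | untwist_ge (i : ℕ) (h : 1 ≤ i ∧ i < n) :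
      Rel lam laminv del z n (FG R n i * FE R n i) (laminv • FE R n i)
  | untwist_eg (i : ℕ) (h : 1 ≤ i ∧ i < n) :
      Rel lam laminv del z n (FE R n i * FG R n i) (laminv • FE R n i)
  | untwist_ege_up (i : ℕ) (h : 1 ≤ i ∧ i + 1 < n) :
      Rel lam laminv del z n (FE R n i * FG R n (i + 1) * FE R n i) (lam • FE R n i)
  | untwist_ege_down (i : ℕ) (h : 1 ≤ i ∧ i + 1 < n) :
      Rel lam laminv del z n (FE R n (i + 1) * FG R n i * FE R n (i + 1))
        (lam • FE R n (i + 1))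

/-- The Birman–Wenzl–Murakami algebra `W_{n,R}`, presented by generators and relations. -/
abbrev Alg (lam laminv del z : R) (n : ℕ) : Type _ :=
  RingQuot (Rel R lam laminv del z n)

variable (lam laminv del z : R) (n : ℕ)

/-- The generator `g i` of `W_{n,R}`. -/
noncomputable def g (i : ℕ) : Alg R lam laminv del z n :=
  RingQuot.mkAlgHom R (Rel R lam laminv del z n) (FG R n i)

/-- The generator `g i⁻¹` of `W_{n,R}`. -/
noncomputable def gi (i : ℕ) : Alg R lam laminv del z n :=
  RingQuot.mkAlgHom R (Rel R lam laminv del z n) (FGi R n i)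

/-- The generator `e i` of `W_{n,R}`. -/
noncomputable def e (i : ℕ) : Alg R lam laminv del z n :=
  RingQuot.mkAlgHom R (Rel R lam laminv del z n) (FE R n i)

end BMW

namespace BMW

section Relations

variable {R : Type*} [CommRing R] {lam laminv del z : R} {n : ℕ}

local notation "G" => g R lam laminv del z n
local notation "Gi" => gi R lam laminv del z n
local notation "E" => e R lam laminv del z n

lemma mk_eq_of_rel {x y : FreeAlgebra R (Gen n)} (h : Rel R lam laminv del z n x y) :
    RingQuot.mkAlgHom R (Rel R lam laminv del z n) x =
      RingQuot.mkAlgHom R (Rel R lam laminv del z n) y :=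
  RingQuot.mkAlgHom_rel R h

lemma gi_mul_g {i : ℕ} (h : 1 ≤ i ∧ i < n) : Gi i * G i = 1 := by
  simpa [g, gi] using mk_eq_of_rel (Rel.inv_left (lam := lam) (laminv := laminv) (del := del)
    (z := z) i h)

lemma g_mul_gi {i : ℕ} (h : 1 ≤ i ∧ i < n) : G i * Gi i = 1 := by
  simpa [g, gi] using mk_eq_of_rel (Rel.inv_right (lam := lam) (laminv := laminv) (del := del)
    (z := z) i h)

lemma e_mul_e {i : ℕ} (h : 1 ≤ i ∧ i < n) : E i * E i = del • E i := by
  simpa [e] using mk_eq_of_rel (Rel.idem (lam := lam) (laminv := laminv) (del := del)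
    (z := z) i h)

lemma braid {i : ℕ} (h : 1 ≤ i ∧ i + 1 < n) :
    G i * G (i + 1) * G i = G (i + 1) * G i * G (i + 1) := by
  simpa [g] using mk_eq_of_rel (Rel.braid (lam := lam) (laminv := laminv) (del := del)
    (z := z) i h)

lemma commute_g_g {i j : ℕ} (h : 1 ≤ i ∧ 1 ≤ j ∧ i < n ∧ j < n ∧ (i + 2 ≤ j ∨ j + 2 ≤ i)) :
    Commute (G i) (G j) := by
  simpa [g, commute_iff_eq] using mk_eq_of_rel (Rel.comm_gg (lam := lam) (laminv := laminv) (del := del)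
    (z := z) i j h)

lemma commute_g_e {i j : ℕ} (h : 1 ≤ i ∧ 1 ≤ j ∧ i < n ∧ j < n ∧ (i + 2 ≤ j ∨ j + 2 ≤ i)) :
    Commute (G i) (E j) := by
  simpa [g, e, commute_iff_eq] using mk_eq_of_rel (Rel.comm_ge (lam := lam) (laminv := laminv) (del := del)
    (z := z) i j h)

lemma commute_e_e {i j : ℕ} (h : 1 ≤ i ∧ 1 ≤ j ∧ i < n ∧ j < n ∧ (i + 2 ≤ j ∨ j + 2 ≤ i)) :
    Commute (E i) (E j) := by
  simpa [e, commute_iff_eq] using mk_eq_of_rel (Rel.comm_ee (lam := lam) (laminv := laminv) (del := del)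
    (z := z) i j h)

lemma e_succ_mul_e_mul_e_succ {i : ℕ} (h : 1 ≤ i ∧ i + 1 < n) :
    E (i + 1) * E i * E (i + 1) = E (i + 1) := by
  simpa [e] using mk_eq_of_rel (Rel.tangle_eee_down (lam := lam) (laminv := laminv) (del := del)
    (z := z) i h)

lemma g_mul_g_succ_mul_e {i : ℕ} (h : 1 ≤ i ∧ i + 1 < n) :
    G i * G (i + 1) * E i = E (i + 1) * E i := by
  simpa [g, e] using mk_eq_of_rel (Rel.tangle_gge_up (lam := lam) (laminv := laminv)
    (del := del) (z := z) i h)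

lemma g_succ_mul_g_mul_e_succ {i : ℕ} (h : 1 ≤ i ∧ i + 1 < n) :
    G (i + 1) * G i * E (i + 1) = E i * E (i + 1) := by
  simpa [g, e] using mk_eq_of_rel (Rel.tangle_gge_down (lam := lam) (laminv := laminv)
    (del := del) (z := z) i h)

lemma e_succ_mul_g_mul_g_succ {i : ℕ} (h : 1 ≤ i ∧ i + 1 < n) :
    E (i + 1) * G i * G (i + 1) = E (i + 1) * E i := by
  simpa [g, e] using mk_eq_of_rel (Rel.tangle_egg_down (lam := lam) (laminv := laminv)
    (del := del) (z := z) i h)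

lemma g_mul_e {i : ℕ} (h : 1 ≤ i ∧ i < n) : G i * E i = laminv • E i := by
  simpa [g, e] using mk_eq_of_rel (Rel.untwist_ge (lam := lam) (laminv := laminv) (del := del)
    (z := z) i h)

lemma e_mul_g {i : ℕ} (h : 1 ≤ i ∧ i < n) : E i * G i = laminv • E i := by
  simpa [g, e] using mk_eq_of_rel (Rel.untwist_eg (lam := lam) (laminv := laminv) (del := del)
    (z := z) i h)

lemma e_succ_mul_g_mul_e_succ {i : ℕ} (h : 1 ≤ i ∧ i + 1 < n) :
    E (i + 1) * G i * E (i + 1) = lam • E (i + 1) := by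
  simpa [g, e] using mk_eq_of_rel (Rel.untwist_ege_down (lam := lam) (laminv := laminv)
    (del := del) (z := z) i h)

lemma g_eq_gi_add {i : ℕ} (h : 1 ≤ i ∧ i < n) : G i = Gi i + z • (E i - 1) := by
  have := mk_eq_of_rel (Rel.skein (lam := lam) (laminv := laminv) (del := del) (z := z) i h)
  simp only [map_sub, map_smul, map_one] at this
  exact sub_eq_iff_eq_add'.mp this

lemma gi_eq_g_sub {i : ℕ} (h : 1 ≤ i ∧ i < n) : Gi i = G i - z • (E i - 1) :=
  eq_sub_of_add_eq (g_eq_gi_add h).symm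

lemma g_mul_g {i : ℕ} (h : 1 ≤ i ∧ i < n) :
    G i * G i = 1 + z • (laminv • E i - G i) := by
  conv_lhs => lhs; rw [g_eq_gi_add h]
  rw [add_mul, gi_mul_g h, smul_mul_assoc, sub_mul, one_mul, e_mul_g h]

lemma g_succ_mul_e_mul_e_succ {i : ℕ} (h : 1 ≤ i ∧ i + 1 < n) :
    G (i + 1) * E i * E (i + 1) = G i * E (i + 1) + z • (E (i + 1) - E i * E (i + 1)) := by
  have h' : 1 ≤ i + 1 ∧ i + 1 < n := ⟨by omega, h.2⟩
  have key : Gi (i + 1) * (E i * E (i + 1)) = G i * E (i + 1) := by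
    rw [← g_succ_mul_g_mul_e_succ h, mul_assoc, ← mul_assoc, gi_mul_g h', one_mul]
  rw [g_eq_gi_add h', add_mul, add_mul, mul_assoc, key, smul_mul_assoc, smul_mul_assoc, sub_mul,
    sub_mul, e_succ_mul_e_mul_e_succ h, one_mul]

lemma e_succ_mul_e_mul_g_succ {i : ℕ} (h : 1 ≤ i ∧ i + 1 < n) :
    E (i + 1) * E i * G (i + 1) = E (i + 1) * G i + z • (E (i + 1) - E (i + 1) * E i) := by
  have h' : 1 ≤ i + 1 ∧ i + 1 < n := ⟨by omega, h.2⟩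
  have key : E (i + 1) * E i * Gi (i + 1) = E (i + 1) * G i := by
    rw [← e_succ_mul_g_mul_g_succ h, mul_assoc, g_mul_gi h', mul_one]
  rw [g_eq_gi_add h', mul_add, key, mul_smul_comm, mul_sub, e_succ_mul_e_mul_e_succ h, mul_one]

lemma g_succ_mul_e_mul_g_succ {i : ℕ} (h : 1 ≤ i ∧ i + 1 < n) :
    G (i + 1) * E i * G (i + 1) =
      Gi i * (E (i + 1) * G i + z • (E (i + 1) - E (i + 1) * E i)) := by
  have key : G (i + 1) * E i = Gi i * (E (i + 1) * E i) := by
    rw [← g_mul_g_succ_mul_e h, mul_assoc, ← mul_assoc, gi_mul_g ⟨h.1, by omega⟩, one_mul]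
  rw [key, mul_assoc, e_succ_mul_e_mul_g_succ h]

end Relations

section Generic

variable {R A : Type*} [CommRing R] [Ring A] [Algebra R A]

/-- If `1 ∈ X` and `X * S * X ≤ S * X * S`, then `S * X * S` is closed under multiplication, so it
contains every subalgebra generated by its elements. -/
lemma adjoin_le_mul_mul {S : Subalgebra R A} {X : Submodule R A} {s : Set A} (hX : 1 ∈ X)
    (hmul : X * S.toSubmodule * X ≤ S.toSubmodule * X * S.toSubmodule)
    (hs : s ⊆ (S.toSubmodule * X * S.toSubmodule : Submodule R A)) :
    (Algebra.adjoin R s).toSubmodule ≤ S.toSubmodule * X * S.toSubmodule := by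
  have hSS : S.toSubmodule * S.toSubmodule = S.toSubmodule := S.isIdempotentElem_toSubmodule
  have hone : (1 : A) ∈ S.toSubmodule * X * S.toSubmodule := by
    have h1 : (1 : A) ∈ S.toSubmodule := S.one_mem
    simpa using Submodule.mul_mem_mul (Submodule.mul_mem_mul h1 hX) h1
  have hclosed : (S.toSubmodule * X * S.toSubmodule) * (S.toSubmodule * X * S.toSubmodule) ≤
      S.toSubmodule * X * S.toSubmodule := by
    calc (S.toSubmodule * X * S.toSubmodule) * (S.toSubmodule * X * S.toSubmodule)
        = S.toSubmodule * (X * (S.toSubmodule * S.toSubmodule) * X) * S.toSubmodule := by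
          simp only [mul_assoc]
      _ ≤ S.toSubmodule * (S.toSubmodule * X * S.toSubmodule) * S.toSubmodule := by
          rw [hSS]; gcongr
      _ = (S.toSubmodule * S.toSubmodule) * X * (S.toSubmodule * S.toSubmodule) := by
          simp only [mul_assoc]
      _ = S.toSubmodule * X * S.toSubmodule := by rw [hSS]
  exact Algebra.adjoin_le (S := (S.toSubmodule * X * S.toSubmodule).toSubalgebra hone
    fun x y hx hy => hclosed (Submodule.mul_mem_mul hx hy)) hs

end Generic

section Decomposition

variable (R : Type*) [CommRing R] (lam laminv del z : R) (n : ℕ)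

/-- The subalgebra of `W_{n,R}` generated by `g i`, `(g i)⁻¹`, `e i` for `1 ≤ i < m`. -/
noncomputable def lowerSubalgebra (m : ℕ) : Subalgebra R (Alg R lam laminv del z n) :=
  Algebra.adjoin R {y : Alg R lam laminv del z n | ∃ i : ℕ, 1 ≤ i ∧ i + 1 ≤ m ∧
    (y = g R lam laminv del z n i ∨ y = gi R lam laminv del z n i ∨
      y = e R lam laminv del z n i)}

/-- The `R`-linear span of `1`, `g m` and `e m`. -/
noncomputable def genSpan (m : ℕ) : Submodule R (Alg R lam laminv del z n) :=
  Submodule.span R {1, g R lam laminv del z n m, e R lam laminv del z n m}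

variable {R lam laminv del z n}

local notation "G" => g R lam laminv del z n
local notation "Gi" => gi R lam laminv del z n
local notation "E" => e R lam laminv del z n
local notation "S" => lowerSubalgebra R lam laminv del z n
local notation "X" => genSpan R lam laminv del z n
local notation "M" m => (Subalgebra.toSubmodule (S m) * X m * Subalgebra.toSubmodule (S m))

lemma one_mem_genSpan (m : ℕ) : 1 ∈ X m := Submodule.subset_span (by simp)

lemma g_mem_genSpan (m : ℕ) : G m ∈ X m := Submodule.subset_span (by simp)

lemma e_mem_genSpan (m : ℕ) : E m ∈ X m := Submodule.subset_span (by simp)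

lemma gi_mem_genSpan {m : ℕ} (h : 1 ≤ m ∧ m < n) : Gi m ∈ X m := by
  rw [gi_eq_g_sub h]
  exact sub_mem (g_mem_genSpan m)
    (Submodule.smul_mem _ _ (sub_mem (e_mem_genSpan m) (one_mem_genSpan m)))

lemma g_mem_lowerSubalgebra {i m : ℕ} (h : 1 ≤ i) (hm : i + 1 ≤ m) : G i ∈ S m :=
  Algebra.subset_adjoin ⟨i, h, hm, by simp⟩

lemma gi_mem_lowerSubalgebra {i m : ℕ} (h : 1 ≤ i) (hm : i + 1 ≤ m) : Gi i ∈ S m :=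
  Algebra.subset_adjoin ⟨i, h, hm, by simp⟩

lemma e_mem_lowerSubalgebra {i m : ℕ} (h : 1 ≤ i) (hm : i + 1 ≤ m) : E i ∈ S m :=
  Algebra.subset_adjoin ⟨i, h, hm, by simp⟩

lemma lowerSubalgebra_mono {k m : ℕ} (h : k ≤ m) : S k ≤ S m :=
  Algebra.adjoin_mono fun _ ⟨i, hi, hk, hy⟩ => ⟨i, hi, hk.trans h, hy⟩

lemma lowerSubalgebra_one : S 1 = ⊥ := by
  rw [lowerSubalgebra, ← Algebra.adjoin_empty]
  congr 1
  ext y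
  simp only [Set.mem_ofPred_eq, Set.mem_empty_iff_false, iff_false]
  rintro ⟨i, hi, hi', -⟩
  omega

lemma mul_mul_mem {m : ℕ} {a x b : Alg R lam laminv del z n} (ha : a ∈ S m) (hx : x ∈ X m)
    (hb : b ∈ S m) : a * x * b ∈ M m :=
  Submodule.mul_mem_mul (Submodule.mul_mem_mul ha hx) hb

lemma mul_mem_of_mem_left {m : ℕ} {a x : Alg R lam laminv del z n} (ha : a ∈ S m)
    (hx : x ∈ X m) : a * x ∈ M m := by
  simpa using mul_mul_mem ha hx (S m).one_mem

lemma mul_mem_of_mem_right {m : ℕ} {x b : Alg R lam laminv del z n} (hx : x ∈ X m)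
    (hb : b ∈ S m) : x * b ∈ M m := by
  simpa using mul_mul_mem (S m).one_mem hx hb

lemma genSpan_le (m : ℕ) : X m ≤ M m := fun _ hx => by
  simpa using mul_mul_mem (S m).one_mem hx (S m).one_mem

lemma lowerSubalgebra_le (m : ℕ) : (S m).toSubmodule ≤ M m := fun _ hx => by
  simpa using mul_mul_mem hx (one_mem_genSpan m) (S m).one_mem

lemma genSpan_mul_genSpan_le {m : ℕ} (h : 1 ≤ m ∧ m < n) : X m * X m ≤ X m := by
  have h1 := one_mem_genSpan (R := R) (lam := lam) (laminv := laminv) (del := del) (z := z)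
    (n := n) m
  have hg := g_mem_genSpan (R := R) (lam := lam) (laminv := laminv) (del := del) (z := z)
    (n := n) m
  have he := e_mem_genSpan (R := R) (lam := lam) (laminv := laminv) (del := del) (z := z)
    (n := n) m
  conv_lhs => rw [genSpan, Submodule.span_mul_span]
  rw [Submodule.span_le]
  rintro _ ⟨x, rfl | rfl | rfl, y, rfl | rfl | rfl, rfl⟩ <;>
    simp only [one_mul, mul_one, SetLike.mem_coe, g_mul_g h, g_mul_e h, e_mul_g h, e_mul_e h]
  all_goals first
    | assumption
    | exact Submodule.smul_mem _ _ he
    | exact add_mem h1 (Submodule.smul_mem _ _ (sub_mem (Submodule.smul_mem _ _ he) hg))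

lemma genSpan_mul_genSpan_mul_genSpan_le {i : ℕ} (h : 1 ≤ i ∧ i + 1 < n) :
    X (i + 1) * X i * X (i + 1) ≤ M (i + 1) := by
  have h' : 1 ≤ i + 1 ∧ i + 1 < n := ⟨by omega, h.2⟩
  have hg : G (i + 1) ∈ X (i + 1) := g_mem_genSpan _
  have he : E (i + 1) ∈ X (i + 1) := e_mem_genSpan _
  have hG : G i ∈ S (i + 1) := g_mem_lowerSubalgebra h.1 le_rfl
  have hGi : Gi i ∈ S (i + 1) := gi_mem_lowerSubalgebra h.1 le_rfl
  have hE : E i ∈ S (i + 1) := e_mem_lowerSubalgebra h.1 le_rfl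
  have hXX : ∀ x ∈ X (i + 1), ∀ y ∈ X (i + 1), x * y ∈ M (i + 1) := fun x hx y hy =>
    genSpan_le _ (genSpan_mul_genSpan_le h' (Submodule.mul_mem_mul hx hy))
  conv_lhs => rw [genSpan, genSpan, Submodule.span_mul_span, Submodule.span_mul_span]
  rw [Submodule.span_le]
  rintro _ ⟨_, ⟨x, rfl | rfl | rfl, y, rfl | rfl | rfl, rfl⟩, w, rfl | rfl | rfl, rfl⟩ <;>
    simp only [one_mul, mul_one, SetLike.mem_coe, ← braid h, e_succ_mul_e_mul_e_succ h,
      g_succ_mul_g_mul_e_succ h, e_succ_mul_g_mul_g_succ h, e_succ_mul_g_mul_e_succ h,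
      g_succ_mul_e_mul_e_succ h, e_succ_mul_e_mul_g_succ h, g_succ_mul_e_mul_g_succ h]
  all_goals first
    | exact lowerSubalgebra_le _ (S (i + 1)).one_mem
    | exact lowerSubalgebra_le _ hG
    | exact lowerSubalgebra_le _ hE
    | exact genSpan_le _ hg
    | exact genSpan_le _ he
    | exact Submodule.smul_mem _ _ (genSpan_le _ he)
    | exact hXX _ hg _ hg
    | exact hXX _ he _ he
    | exact hXX _ hg _ he
    | exact hXX _ he _ hg
    | exact mul_mem_of_mem_left hG hg
    | exact mul_mem_of_mem_left hG he
    | exact mul_mem_of_mem_left hE hg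
    | exact mul_mem_of_mem_left hE he
    | exact mul_mem_of_mem_right hg hG
    | exact mul_mem_of_mem_right he hG
    | exact mul_mem_of_mem_right hg hE
    | exact mul_mem_of_mem_right he hE
    | exact mul_mul_mem hG hg hG
    | exact add_mem (mul_mem_of_mem_left hG he) (Submodule.smul_mem _ _
        (sub_mem (genSpan_le _ he) (mul_mem_of_mem_left hE he)))
    | exact add_mem (mul_mem_of_mem_right he hG) (Submodule.smul_mem _ _
        (sub_mem (genSpan_le _ he) (mul_mem_of_mem_right he hE)))
    | rw [mul_add, mul_smul_comm, mul_sub, ← mul_assoc, ← mul_assoc]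
      exact add_mem (mul_mul_mem hGi he hG) (Submodule.smul_mem _ _
        (sub_mem (mul_mem_of_mem_left hGi he) (mul_mul_mem hGi he hE)))

lemma lowerSubalgebra_commute {i : ℕ} (h : 1 ≤ i ∧ i + 1 < n) {a x : Alg R lam laminv del z n}
    (ha : a ∈ S i) (hx : x ∈ X (i + 1)) : Commute a x := by
  have hcomm : ∀ x ∈ ({1, G (i + 1), E (i + 1)} : Set (Alg R lam laminv del z n)),
      Commute a x := by
    intro x hx
    refine Algebra.adjoin_induction (p := fun a _ => Commute a x) ?_
      (fun r => Algebra.commutes r x) (fun _ _ _ _ h₁ h₂ => h₁.add_left h₂)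
      (fun _ _ _ _ h₁ h₂ => h₁.mul_left h₂) ha
    have hgx : ∀ j, 1 ≤ j → j + 1 ≤ i → Commute (G j) x := by
      intro j hj hji
      rcases hx with rfl | rfl | rfl
      · exact Commute.one_right _
      · exact commute_g_g ⟨by omega, by omega, by omega, by omega, by omega⟩
      · exact commute_g_e ⟨by omega, by omega, by omega, by omega, by omega⟩
    have hex : ∀ j, 1 ≤ j → j + 1 ≤ i → Commute (E j) x := by
      intro j hj hji
      rcases hx with rfl | rfl | rfl
      · exact Commute.one_right _
      · exact (commute_g_e ⟨by omega, by omega, by omega, by omega, by omega⟩).symm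
      · exact commute_e_e ⟨by omega, by omega, by omega, by omega, by omega⟩
    rintro _ ⟨j, hj, hji, rfl | rfl | rfl⟩
    · exact hgx j hj hji
    · rw [gi_eq_g_sub ⟨hj, by omega⟩]
      exact (hgx j hj hji).sub_left (((hex j hj hji).sub_left (Commute.one_left x)).smul_left z)
    · exact hex j hj hji
  induction hx using Submodule.span_induction with
  | mem x hx => exact hcomm x hx
  | zero => exact Commute.zero_right a
  | add x y _ _ hx hy => exact hx.add_right hy
  | smul r x _ hx => exact hx.smul_right r

lemma lowerSubalgebra_mul_genSpan_comm {i : ℕ} (h : 1 ≤ i ∧ i + 1 < n) :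
    (S i).toSubmodule * X (i + 1) = X (i + 1) * (S i).toSubmodule :=
  Submodule.mul_comm_of_commute fun _ ha _ hx => lowerSubalgebra_commute h ha hx

lemma lowerSubalgebra_succ_le_of_mul_le {m : ℕ} (h : m < n)
    (hmul : X m * (S m).toSubmodule * X m ≤ M m) : (S (m + 1)).toSubmodule ≤ M m := by
  refine adjoin_le_mul_mul (one_mem_genSpan m) hmul ?_
  rintro y ⟨i, hi, him, hy⟩
  rcases (show i + 1 ≤ m ∨ i = m by omega) with him | rfl
  · exact lowerSubalgebra_le m (Algebra.subset_adjoin ⟨i, hi, him, hy⟩)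
  · rcases hy with rfl | rfl | rfl
    · exact genSpan_le _ (g_mem_genSpan _)
    · exact genSpan_le _ (gi_mem_genSpan ⟨hi, h⟩)
    · exact genSpan_le _ (e_mem_genSpan _)

/-- Each subalgebra in the tower is generated as a bimodule over the previous one by `1`, `g m`
and `e m`. -/
theorem lowerSubalgebra_succ_le {m : ℕ} (hm : 1 ≤ m) (h : m < n) :
    (S (m + 1)).toSubmodule ≤ M m := by
  induction m, hm using Nat.le_induction with
  | base =>
    apply lowerSubalgebra_succ_le_of_mul_le h
    rw [lowerSubalgebra_one, Algebra.toSubmodule_bot, mul_one, one_mul, mul_one]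
    exact genSpan_mul_genSpan_le ⟨le_rfl, h⟩
  | succ i hi ih =>
    apply lowerSubalgebra_succ_le_of_mul_le h
    have hrec : (S (i + 1)).toSubmodule ≤ M i := ih (by omega)
    have hle : (S i).toSubmodule ≤ (S (i + 1)).toSubmodule := lowerSubalgebra_mono i.le_succ
    have hSS : (S (i + 1)).toSubmodule * (S (i + 1)).toSubmodule = (S (i + 1)).toSubmodule :=
      (S (i + 1)).isIdempotentElem_toSubmodule
    have hc := lowerSubalgebra_mul_genSpan_comm (R := R) (lam := lam) (laminv := laminv)
      (del := del) (z := z) ⟨hi, h⟩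
    calc X (i + 1) * (S (i + 1)).toSubmodule * X (i + 1)
        ≤ X (i + 1) * (M i) * X (i + 1) := by gcongr
      _ = (X (i + 1) * (S i).toSubmodule) * X i * ((S i).toSubmodule * X (i + 1)) := by
          simp only [mul_assoc]
      _ = (S i).toSubmodule * (X (i + 1) * X i * X (i + 1)) * (S i).toSubmodule := by
          conv_lhs => arg 2; rw [hc]
          conv_lhs => arg 1; rw [← hc]
          simp only [mul_assoc]
      _ ≤ (S (i + 1)).toSubmodule * (M (i + 1)) * (S (i + 1)).toSubmodule := by
          exact mul_le_mul' (mul_le_mul' hle (genSpan_mul_genSpan_mul_genSpan_le ⟨hi, h⟩)) hle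
      _ = ((S (i + 1)).toSubmodule * (S (i + 1)).toSubmodule) * X (i + 1) *
            ((S (i + 1)).toSubmodule * (S (i + 1)).toSubmodule) := by simp only [mul_assoc]
      _ = M (i + 1) := by rw [hSS]

lemma lowerSubalgebra_self : S n = ⊤ := by
  rw [eq_top_iff]
  rintro y -
  obtain ⟨w, rfl⟩ := RingQuot.mkAlgHom_surjective R (Rel R lam laminv del z n) y
  induction w using FreeAlgebra.induction with
  | grade0 r => simp
  | grade1 x =>
    cases x with
    | g i h =>
      have hi : G i ∈ S n := g_mem_lowerSubalgebra h.1 h.2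
      rwa [g, FG, dif_pos h] at hi
    | gi i h =>
      have hi : Gi i ∈ S n := gi_mem_lowerSubalgebra h.1 h.2
      rwa [gi, FGi, dif_pos h] at hi
    | e i h =>
      have hi : E i ∈ S n := e_mem_lowerSubalgebra h.1 h.2
      rwa [e, FE, dif_pos h] at hi
  | mul a b ha hb => rw [map_mul]; exact mul_mem ha hb
  | add a b ha hb => rw [map_add]; exact add_mem ha hb

end Decomposition

end BMW

namespace BMW

/-- For `n ≥ 2`, `W_{n,R}` is spanned as an `R`-module by elements
`a · χ · b` with `a, b` in the subalgebra generated by `{g_i, g_i⁻¹, e_i : 1 ≤ i ≤ n-2}`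
and `χ ∈ {1, g_{n-1}, g_{n-1}⁻¹, e_{n-1}}`. -/
theorem bimodule_decomposition
    (R : Type*) [CommRing R] (lam laminv del delinv z : R)
    (hlam : lam * laminv = 1) (hdel : del * delinv = 1)
    (hskein : laminv - lam = z * (del - 1)) (n : ℕ) (hn : 2 ≤ n) :
    Submodule.span R
      {t : Alg R lam laminv del z n |
        ∃ a ∈ Algebra.adjoin R
            {y : Alg R lam laminv del z n | ∃ i : ℕ, 1 ≤ i ∧ i + 2 ≤ n ∧
              (y = g R lam laminv del z n i ∨ y = gi R lam laminv del z n i ∨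
                y = e R lam laminv del z n i)},
        ∃ b ∈ Algebra.adjoin R
            {y : Alg R lam laminv del z n | ∃ i : ℕ, 1 ≤ i ∧ i + 2 ≤ n ∧
              (y = g R lam laminv del z n i ∨ y = gi R lam laminv del z n i ∨
                y = e R lam laminv del z n i)},
        ∃ χ ∈ ({1, g R lam laminv del z n (n - 1), gi R lam laminv del z n (n - 1),
            e R lam laminv del z n (n - 1)} : Set (Alg R lam laminv del z n)),
          t = a * χ * b} = ⊤ := by
  obtain ⟨m, rfl⟩ : ∃ m, n = m + 1 := ⟨n - 1, by omega⟩
  simp only [← Nat.succ_eq_add_one, Nat.succ_le_succ_iff, Nat.add_succ _ 1]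
  rw [eq_top_iff, ← Algebra.top_toSubmodule, ← lowerSubalgebra_self]
  refine (lowerSubalgebra_succ_le (by omega) m.lt_succ_self).trans ?_
  rw [← Submodule.span_eq (Subalgebra.toSubmodule _), genSpan, Submodule.span_mul_span,
    Submodule.span_mul_span]
  apply Submodule.span_mono
  rintro _ ⟨_, ⟨a, ha, χ, hχ, rfl⟩, b, hb, rfl⟩
  refine ⟨a, ha, b, hb, χ, ?_, rfl⟩
  rcases hχ with rfl | rfl | rfl <;> simp

end BMW
end

section
/- In W_{2k,R} (k ≥ 1), let W_k denote the subalgebra generated by {g_i, g_i⁻¹, e_i : 1 ≤ i ≤ k−1}. Then: (1) the left ideal W_{2k,R}·f_k equals the S-submodule spanned by {a·f_k : a ∈ W_k}, and the right ideal f_k·W_{2k,R} equals the span of {f_k·a : a ∈ W_k}; (2) the two-sided ideal of W_{2k,R} generated by e_1 e_3 ⋯ e_{2k−1} equals the two-sided ideal generated by f_k, and equals the R-submodule spanned by {a·f_k·b : a, b ∈ W_k}. -/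
namespace BMW

variable (R : Type*) [CommRing R] (lam laminv del z : R) (n : ℕ)

/-- The ascending product `g_1 g_2 ⋯ g_k`. -/
noncomputable def gasc : ℕ → Alg R lam laminv del z n
  | 0 => 1
  | k + 1 => gasc k * g R lam laminv del z n (k + 1)

/-- The descending product `g_k ⋯ g_2 g_1`. -/
noncomputable def gdesc : ℕ → Alg R lam laminv del z n
  | 0 => 1
  | k + 1 => g R lam laminv del z n (k + 1) * gdesc k

/-- The elements `f_k`: `f_1 = e_1` and
`f_k = (g_1 ⋯ g_{2k-2}) f_{k-1} e_{2k-1} (g_{2k-2} ⋯ g_1)` for `k ≥ 2`. -/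
noncomputable def fk : ℕ → Alg R lam laminv del z n
  | 0 => 1
  | 1 => e R lam laminv del z n 1
  | k + 2 =>
      gasc R lam laminv del z n (2 * k + 2) * fk (k + 1) *
        e R lam laminv del z n (2 * k + 3) * gdesc R lam laminv del z n (2 * k + 2)

/-- The product `e_1 e_3 ⋯ e_{2k-1}`. -/
noncomputable def eodd : ℕ → Alg R lam laminv del z n
  | 0 => 1
  | k + 1 => eodd k * e R lam laminv del z n (2 * k + 1)

end BMW

namespace BMW

open Algebra MulOpposite

/-- Indices in range that differ by one. -/
def Adj (n i j : ℕ) : Prop := 1 ≤ i ∧ i < n ∧ 1 ≤ j ∧ j < n ∧ (j = i + 1 ∨ i = j + 1)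

/-- Indices in range that differ by at least two. -/
def Far (n i j : ℕ) : Prop := 1 ≤ i ∧ i < n ∧ 1 ≤ j ∧ j < n ∧ (i + 2 ≤ j ∨ j + 2 ≤ i)

/-- Families in an `R`-algebra that satisfy the Birman–Wenzl–Murakami relations. -/
structure IsBMW {R A : Type*} [CommRing R] [Ring A] [Algebra R A] (lam laminv del z : R)
    (n : ℕ) (g gi e : ℕ → A) : Prop where
  mul_inv : ∀ i, 1 ≤ i → i < n → g i * gi i = 1
  inv_mul : ∀ i, 1 ≤ i → i < n → gi i * g i = 1
  e_sq : ∀ i, 1 ≤ i → i < n → e i * e i = del • e i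
  braid : ∀ i j, Adj n i j → g i * (g j * g i) = g j * (g i * g j)
  far_gg : ∀ i j, Far n i j → g i * g j = g j * g i
  far_ge : ∀ i j, Far n i j → g i * e j = e j * g i
  far_ee : ∀ i j, Far n i j → e i * e j = e j * e i
  eee : ∀ i j, Adj n i j → e i * (e j * e i) = e i
  gge : ∀ i j, Adj n i j → g i * (g j * e i) = e j * e i
  egg : ∀ i j, Adj n i j → e i * (g j * g i) = e i * e j
  skein : ∀ i, 1 ≤ i → i < n → g i - gi i = z • (e i - 1)
  g_e : ∀ i, 1 ≤ i → i < n → g i * e i = laminv • e i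
  e_g : ∀ i, 1 ≤ i → i < n → e i * g i = laminv • e i
  ege : ∀ i j, Adj n i j → e i * (g j * e i) = lam • e i

/-- The generators with index in `[a, b)`. -/
def gens {A : Type*} (g gi e : ℕ → A) (a b : ℕ) : Set A :=
  {u | ∃ i : ℕ, a ≤ i ∧ i < b ∧ (u = g i ∨ u = gi i ∨ u = e i)}

/-- The product `g_1 ⋯ g_m`. -/
def ascProd {A : Type*} [Monoid A] (g : ℕ → A) : ℕ → A
  | 0 => 1
  | m + 1 => ascProd g m * g (m + 1)

/-- The product `e_1 e_3 ⋯ e_{2k-1}`. -/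
def oddProd {A : Type*} [Monoid A] (e : ℕ → A) : ℕ → A
  | 0 => 1
  | k + 1 => oddProd e k * e (2 * k + 1)

/-- The product `(g_1 ⋯ g_{2k-2}) (g_1 ⋯ g_{2k-4}) ⋯ (g_1 g_2)`. -/
def nest {A : Type*} [Monoid A] (g : ℕ → A) : ℕ → A
  | 0 => 1
  | k + 1 => ascProd g (2 * k) * nest g k

/-- The elements of `A` whose left multiplication preserves the submodule `M`. -/
def leftStab {R A : Type*} [CommRing R] [Ring A] [Algebra R A] (M : Submodule R A) :
    Subalgebra R A where
  carrier := {x | ∀ m ∈ M, x * m ∈ M}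
  mul_mem' := fun {x y} hx hy m hm ↦ by rw [mul_assoc]; exact hx _ (hy _ hm)
  add_mem' := fun {x y} hx hy m hm ↦ by rw [add_mul]; exact M.add_mem (hx _ hm) (hy _ hm)
  algebraMap_mem' := fun r m hm ↦ by rw [← Algebra.smul_def]; exact M.smul_mem r hm

/-- The span of `1`, `g` and `e`. -/
def triple (R : Type*) {A : Type*} [CommRing R] [Ring A] [Algebra R A] (g e : A) :
    Submodule R A :=
  Submodule.span R {1, g, e}

section gens

variable {R A : Type*} [CommRing R] [Ring A] [Algebra R A] {g gi e : ℕ → A} {a b c d i : ℕ}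

lemma g_mem_adjoin (ha : a ≤ i) (hb : i < b) : g i ∈ adjoin R (gens g gi e a b) :=
  subset_adjoin ⟨i, ha, hb, Or.inl rfl⟩

lemma gi_mem_adjoin (ha : a ≤ i) (hb : i < b) : gi i ∈ adjoin R (gens g gi e a b) :=
  subset_adjoin ⟨i, ha, hb, Or.inr (Or.inl rfl)⟩

lemma e_mem_adjoin (ha : a ≤ i) (hb : i < b) : e i ∈ adjoin R (gens g gi e a b) :=
  subset_adjoin ⟨i, ha, hb, Or.inr (Or.inr rfl)⟩

lemma adjoin_gens_mono (hca : c ≤ a) (hbd : b ≤ d) :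
    adjoin R (gens g gi e a b) ≤ adjoin R (gens g gi e c d) :=
  adjoin_mono fun _ ⟨i, h1, h2, h3⟩ ↦ ⟨i, hca.trans h1, h2.trans_le hbd, h3⟩

lemma ascProd_mem (m : ℕ) : ascProd g m ∈ adjoin R (gens g gi e 1 (m + 1)) := by
  induction m with
  | zero => exact one_mem _
  | succ m ih =>
    exact mul_mem (adjoin_gens_mono le_rfl (by omega) ih) (g_mem_adjoin (by omega) (by omega))

lemma nest_mem (k : ℕ) : nest g k ∈ adjoin R (gens g gi e 1 (2 * k)) := by
  induction k with
  | zero => exact one_mem _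
  | succ k ih =>
    exact mul_mem (adjoin_gens_mono le_rfl (by omega) (ascProd_mem _))
      (adjoin_gens_mono le_rfl (by omega) ih)

lemma oddProd_mem (k : ℕ) : oddProd e k ∈ adjoin R (gens g gi e 1 (2 * k)) := by
  induction k with
  | zero => exact one_mem _
  | succ k ih =>
    exact mul_mem (adjoin_gens_mono le_rfl (by omega) ih) (e_mem_adjoin (by omega) (by omega))

lemma one_mem_triple (x y : A) : (1 : A) ∈ triple R x y := Submodule.subset_span (by simp)

lemma fst_mem_triple (x y : A) : x ∈ triple R x y := Submodule.subset_span (by simp)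

lemma snd_mem_triple (x y : A) : y ∈ triple R x y := Submodule.subset_span (by simp)

lemma triple_le {x y : A} {M : Submodule R A} (h1 : 1 ∈ M) (hx : x ∈ M) (hy : y ∈ M) :
    triple R x y ≤ M := by
  refine Submodule.span_le.2 ?_
  rintro _ (rfl | rfl | rfl) <;> assumption

lemma nest_mul_oddProd_succ {A : Type*} [Monoid A] (g e : ℕ → A) (k : ℕ) :
    nest g (k + 1) * oddProd e (k + 1) =
      ascProd g (2 * k) * ((nest g k * oddProd e k) * e (2 * k + 1)) := by
  simp only [nest, oddProd, mul_assoc]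

lemma nest_mul_oddProd_mem (k : ℕ) :
    nest g k * oddProd e k ∈ adjoin R (gens g gi e 1 (2 * k)) :=
  mul_mem (nest_mem k) (oddProd_mem k)

lemma triple_map_mem {x y c : A} (hc : c ∈ triple R x y) (f : A →ₗ[R] A) {N : Submodule R A}
    (h1 : f 1 ∈ N) (hx : f x ∈ N) (hy : f y ∈ N) : f c ∈ N :=
  triple_le (M := N.comap f) h1 hx hy hc

lemma mul_mul_le {S C N : Submodule R A} (h : ∀ a ∈ S, ∀ c ∈ C, ∀ b ∈ S, a * c * b ∈ N) :
    S * C * S ≤ N :=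
  Submodule.mul_le.2 fun _ hm b hb ↦ (Submodule.mul_le.2 fun a ha c hc ↦ h a ha c hc b hb :
    S * C ≤ N.comap (LinearMap.mulRight R b)) hm

lemma mem_mul_mul (S : Subalgebra R A) {C : Submodule R A} {c : A} (hc : c ∈ C) :
    c ∈ S.toSubmodule * C * S.toSubmodule := by
  have h1 : (1 : A) * c * 1 ∈ S.toSubmodule * C * S.toSubmodule :=
    Submodule.mul_mem_mul (Submodule.mul_mem_mul (one_mem S) hc) (one_mem S)
  rwa [one_mul, mul_one] at h1

lemma mul_left_mem_mul_mul {S : Subalgebra R A} {C : Submodule R A} {a x : A} (ha : a ∈ S)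
    (hx : x ∈ S.toSubmodule * C * S.toSubmodule) :
    a * x ∈ S.toSubmodule * C * S.toSubmodule := by
  refine mul_mul_le (N := (S.toSubmodule * C * S.toSubmodule).comap (LinearMap.mulLeft R a))
    (fun s hs c hc t ht ↦ ?_) hx
  rw [Submodule.mem_comap, LinearMap.mulLeft_apply, ← mul_assoc, ← mul_assoc]
  exact Submodule.mul_mem_mul (Submodule.mul_mem_mul (S.mul_mem ha hs) hc) ht

lemma mul_right_mem_mul_mul {S : Subalgebra R A} {C : Submodule R A} {b x : A} (hb : b ∈ S)
    (hx : x ∈ S.toSubmodule * C * S.toSubmodule) :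
    x * b ∈ S.toSubmodule * C * S.toSubmodule := by
  refine mul_mul_le (N := (S.toSubmodule * C * S.toSubmodule).comap (LinearMap.mulRight R b))
    (fun s hs c hc t ht ↦ ?_) hx
  rw [Submodule.mem_comap, LinearMap.mulRight_apply, mul_assoc _ t]
  exact Submodule.mul_mem_mul (Submodule.mul_mem_mul hs hc) (S.mul_mem ht hb)

end gens

namespace IsBMW

variable {R A : Type*} [CommRing R] [Ring A] [Algebra R A] {lam laminv del z : R} {n : ℕ}
  {g gi e : ℕ → A}

lemma gi_eq (h : IsBMW lam laminv del z n g gi e) {i : ℕ} (h1 : 1 ≤ i) (h2 : i < n) :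
    gi i = g i - z • (e i - 1) := by
  rw [← h.skein i h1 h2]; abel

lemma isUnit_g (h : IsBMW lam laminv del z n g gi e) {i : ℕ} (h1 : 1 ≤ i) (h2 : i < n) :
    IsUnit (g i) :=
  ⟨⟨g i, gi i, h.mul_inv i h1 h2, h.inv_mul i h1 h2⟩, rfl⟩

/-- The relations are invariant under reversal of words. -/
lemma op (h : IsBMW lam laminv del z n g gi e) :
    IsBMW lam laminv del z n (fun i ↦ op (g i)) (fun i ↦ op (gi i)) (fun i ↦ op (e i)) where
  mul_inv i h1 h2 := unop_injective (h.inv_mul i h1 h2)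
  inv_mul i h1 h2 := unop_injective (h.mul_inv i h1 h2)
  e_sq i h1 h2 := unop_injective (h.e_sq i h1 h2)
  braid i j hij := unop_injective (by simpa [mul_assoc] using h.braid i j hij)
  far_gg i j hij := unop_injective (h.far_gg i j hij).symm
  far_ge i j hij := unop_injective (h.far_ge i j hij).symm
  far_ee i j hij := unop_injective (h.far_ee i j hij).symm
  eee i j hij := unop_injective (by simpa [mul_assoc] using h.eee i j hij)
  gge i j hij := unop_injective (by simpa [mul_assoc] using h.egg i j hij)
  egg i j hij := unop_injective (by simpa [mul_assoc] using h.gge i j hij)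
  skein i h1 h2 := unop_injective (h.skein i h1 h2)
  g_e i h1 h2 := unop_injective (h.e_g i h1 h2)
  e_g i h1 h2 := unop_injective (h.g_e i h1 h2)
  ege i j hij := unop_injective (by simpa [mul_assoc] using h.ege i j hij)

lemma commute_gens (h : IsBMW lam laminv del z n g gi e) {a b c d : ℕ} (ha : 1 ≤ a)
    (hbc : b + 1 ≤ c) (hd : d ≤ n) {x y : A} (hx : x ∈ gens g gi e a b)
    (hy : y ∈ gens g gi e c d) : Commute x y := by
  obtain ⟨i, hai, hib, hx⟩ := hx
  obtain ⟨j, hcj, hjd, hy⟩ := hy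
  have hij : Far n i j := ⟨by omega, by omega, by omega, by omega, by omega⟩
  have hji : Far n j i := ⟨by omega, by omega, by omega, by omega, by omega⟩
  have hgg : Commute (g i) (g j) := h.far_gg _ _ hij
  have hge : Commute (g i) (e j) := h.far_ge _ _ hij
  have heg : Commute (e i) (g j) := (h.far_ge _ _ hji).symm
  have hee : Commute (e i) (e j) := h.far_ee _ _ hij
  have key : ∀ {u : A}, Commute (g i) u → Commute (e i) u → Commute x u := by
    intro u hg he
    rcases hx with rfl | rfl | rfl
    · exact hg
    · rw [h.gi_eq (i := i) (by omega) (by omega)]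
      exact hg.sub_left ((he.sub_left (Commute.one_left u)).smul_left z)
    · exact he
  have hxg := key hgg heg
  have hxe := key hge hee
  rcases hy with rfl | rfl | rfl
  · exact hxg
  · rw [h.gi_eq (i := j) (by omega) (by omega)]
    exact hxg.sub_right ((hxe.sub_right (Commute.one_right x)).smul_right z)
  · exact hxe

lemma commute_adjoin (h : IsBMW lam laminv del z n g gi e) {a b c d : ℕ} (ha : 1 ≤ a)
    (hbc : b + 1 ≤ c) (hd : d ≤ n) {x y : A} (hx : x ∈ adjoin R (gens g gi e a b))
    (hy : y ∈ adjoin R (gens g gi e c d)) : Commute x y := by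
  have h1 : ∀ u ∈ gens g gi e a b, Commute u y := fun u hu ↦
    (Subalgebra.mem_centralizer_iff R).1 ((adjoin_le (S := Subalgebra.centralizer R {u})
      fun v hv ↦ (Subalgebra.mem_centralizer_iff R).2 fun w hw ↦ by
        rw [Set.mem_singleton_iff.1 hw]; exact h.commute_gens ha hbc hd hu hv) hy) u rfl
  exact ((Subalgebra.mem_centralizer_iff R).1 ((adjoin_le (S := Subalgebra.centralizer R {y})
      fun v hv ↦ (Subalgebra.mem_centralizer_iff R).2 fun w hw ↦ by
        rw [Set.mem_singleton_iff.1 hw]; exact (h1 v hv).symm) hx) y rfl).symm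

lemma isUnit_ascProd (h : IsBMW lam laminv del z n g gi e) {m : ℕ} (hm : m < n) :
    IsUnit (ascProd g m) := by
  induction m with
  | zero => exact isUnit_one
  | succ m ih => exact (ih (by omega)).mul (h.isUnit_g (by omega) hm)

lemma isUnit_nest (h : IsBMW lam laminv del z n g gi e) {k : ℕ} (hk : 2 * k ≤ n) :
    IsUnit (nest g k) := by
  induction k with
  | zero => exact isUnit_one
  | succ k ih => exact (h.isUnit_ascProd (by omega)).mul (ih (by omega))

lemma g_mul_ascProd (h : IsBMW lam laminv del z n g gi e) {i m : ℕ} (hi : 1 ≤ i)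
    (him : i + 1 ≤ m) (hm : m < n) : g (i + 1) * ascProd g m = ascProd g m * g i := by
  induction m, him using Nat.le_induction with
  | base =>
    obtain ⟨j, rfl⟩ : ∃ j, i = j + 1 := ⟨i - 1, by omega⟩
    have hc : Commute (ascProd g j) (g (j + 2)) := h.commute_adjoin (d := j + 3) le_rfl le_rfl
      (by omega) (ascProd_mem (gi := gi) (e := e) j) (g_mem_adjoin le_rfl (by omega))
    have hb := h.braid (j + 1) (j + 2) ⟨by omega, by omega, by omega, by omega, by omega⟩
    simp only [ascProd, mul_assoc]
    rw [← mul_assoc, ← hc.eq, mul_assoc, hb]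
  | succ m him ih =>
    have hc := h.far_gg i (m + 1) ⟨by omega, by omega, by omega, by omega, by omega⟩
    simp only [ascProd]
    rw [← mul_assoc, ih (by omega), mul_assoc, mul_assoc, hc]

lemma e_mul_ascProd (h : IsBMW lam laminv del z n g gi e) {i m : ℕ} (hi : 1 ≤ i)
    (him : i + 1 ≤ m) (hm : m < n) : e (i + 1) * ascProd g m = ascProd g m * e i := by
  induction m, him using Nat.le_induction with
  | base =>
    obtain ⟨j, rfl⟩ : ∃ j, i = j + 1 := ⟨i - 1, by omega⟩
    have hc : Commute (ascProd g j) (e (j + 2)) := h.commute_adjoin (d := j + 3) le_rfl le_rfl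
      (by omega) (ascProd_mem (gi := gi) (e := e) j) (e_mem_adjoin le_rfl (by omega))
    have h1 := h.egg (j + 2) (j + 1) ⟨by omega, by omega, by omega, by omega, by omega⟩
    have h2 := h.gge (j + 1) (j + 2) ⟨by omega, by omega, by omega, by omega, by omega⟩
    simp only [ascProd, mul_assoc]
    rw [← mul_assoc, ← hc.eq, mul_assoc, h1, h2]
  | succ m him ih =>
    have hc := h.far_ge (m + 1) i ⟨by omega, by omega, by omega, by omega, by omega⟩
    simp only [ascProd]
    rw [← mul_assoc, ih (by omega), mul_assoc, mul_assoc, hc]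

lemma ascProd_mul_ascProd (h : IsBMW lam laminv del z n g gi e) {p q : ℕ} (hqp : q ≤ p)
    (hp : p + 2 < n) :
    ascProd g (q + 1) * ascProd g (p + 2) = g 1 * (ascProd g (p + 2) * ascProd g q) := by
  induction q with
  | zero => simp [ascProd]
  | succ q ih =>
    rw [ascProd, mul_assoc, h.g_mul_ascProd (by omega) (by omega) hp, ← mul_assoc,
      ih (by omega)]
    simp only [mul_assoc, show ascProd g (q + 1) = ascProd g q * g (q + 1) from rfl]

lemma flip_g_one (h : IsBMW lam laminv del z n g gi e) {p : ℕ} (hp : 2 * p + 3 < n) :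
    g (2 * p + 3) * (nest g (p + 2) * oddProd e (p + 2)) =
      g 1 * (nest g (p + 2) * oddProd e (p + 2)) := by
  have hX : nest g (p + 2) * oddProd e (p + 2) = ascProd g (2 * p + 2) * (ascProd g (2 * p) *
      ((nest g p * oddProd e p) * (e (2 * p + 1) * e (2 * p + 3)))) := by
    rw [nest_mul_oddProd_succ, nest_mul_oddProd_succ]
    simp only [mul_assoc, mul_add, mul_one, add_assoc]
  have hXp := nest_mul_oddProd_mem (R := R) (g := g) (gi := gi) (e := e) p
  have hasc := ascProd_mem (R := R) (g := g) (gi := gi) (e := e) (2 * p)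
  have hasc' := ascProd_mem (R := R) (g := g) (gi := gi) (e := e) (2 * p + 1)
  have hg1 : g (2 * p + 1) ∈ adjoin R (gens g gi e (2 * p + 1) (2 * p + 4)) :=
    g_mem_adjoin (by omega) (by omega)
  have hg2 : g (2 * p + 2) ∈ adjoin R (gens g gi e (2 * p + 1) (2 * p + 4)) :=
    g_mem_adjoin (by omega) (by omega)
  have hg2' : g (2 * p + 2) ∈ adjoin R (gens g gi e (2 * p + 2) (2 * p + 4)) :=
    g_mem_adjoin (by omega) (by omega)
  have hg3 : g (2 * p + 3) ∈ adjoin R (gens g gi e (2 * p + 3) (2 * p + 4)) :=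
    g_mem_adjoin (by omega) (by omega)
  have c1 : Commute (ascProd g (2 * p + 1)) (g (2 * p + 3)) :=
    h.commute_adjoin le_rfl (by omega) (by omega) hasc' hg3
  have c2 : Commute (ascProd g (2 * p)) (g (2 * p + 3) * g (2 * p + 2)) :=
    h.commute_adjoin le_rfl (by omega) (by omega) hasc
      (mul_mem (adjoin_gens_mono (by omega) le_rfl hg3) hg2')
  have c3 : Commute (nest g p * oddProd e p) (g (2 * p + 3) * g (2 * p + 2)) :=
    h.commute_adjoin le_rfl (by omega) (by omega) hXp
      (mul_mem (adjoin_gens_mono (by omega) le_rfl hg3) hg2)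
  have c4 : Commute (nest g p * oddProd e p) (g (2 * p + 1) * g (2 * p + 2)) :=
    h.commute_adjoin le_rfl (by omega) (by omega) hXp (mul_mem hg1 hg2)
  have hee := h.far_ee (2 * p + 1) (2 * p + 3) ⟨by omega, by omega, by omega, by omega, by omega⟩
  have hr1 := h.gge (2 * p + 3) (2 * p + 2) ⟨by omega, by omega, by omega, by omega, by omega⟩
  have hr2 := h.gge (2 * p + 1) (2 * p + 2) ⟨by omega, by omega, by omega, by omega, by omega⟩
  have hr : (g (2 * p + 3) * g (2 * p + 2)) * (e (2 * p + 1) * e (2 * p + 3)) =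
      (g (2 * p + 1) * g (2 * p + 2)) * (e (2 * p + 1) * e (2 * p + 3)) := by
    have t1 : (g (2 * p + 3) * g (2 * p + 2)) * e (2 * p + 3) = e (2 * p + 2) * e (2 * p + 3) := by
      rw [mul_assoc, hr1]
    have t2 : (g (2 * p + 1) * g (2 * p + 2)) * e (2 * p + 1) = e (2 * p + 2) * e (2 * p + 1) := by
      rw [mul_assoc, hr2]
    rw [← mul_assoc (g (2 * p + 1) * g (2 * p + 2)), t2, hee, ← mul_assoc, t1, mul_assoc,
      mul_assoc, hee]
  have hA := h.ascProd_mul_ascProd (p := 2 * p) (q := 2 * p) le_rfl (by omega)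
  have hs : ascProd g (2 * p + 2) = ascProd g (2 * p + 1) * g (2 * p + 2) := rfl
  have hs' : ascProd g (2 * p) * (g (2 * p + 1) * g (2 * p + 2)) = ascProd g (2 * p + 2) := by
    simp only [ascProd, mul_assoc]
  rw [hX]
  set E := e (2 * p + 1) * e (2 * p + 3)
  set X := nest g p * oddProd e p
  calc g (2 * p + 3) * (ascProd g (2 * p + 2) * (ascProd g (2 * p) * (X * E)))
      = (g (2 * p + 3) * ascProd g (2 * p + 1)) *
          (g (2 * p + 2) * (ascProd g (2 * p) * (X * E))) := by rw [hs]; simp only [mul_assoc]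
    _ = ascProd g (2 * p + 1) *
          (((g (2 * p + 3) * g (2 * p + 2)) * ascProd g (2 * p)) * (X * E)) := by
        rw [← c1.eq]; simp only [mul_assoc]
    _ = ascProd g (2 * p + 1) *
          (ascProd g (2 * p) * (((g (2 * p + 3) * g (2 * p + 2)) * X) * E)) := by
        rw [← c2.eq]; simp only [mul_assoc]
    _ = ascProd g (2 * p + 1) *
          (ascProd g (2 * p) * ((X * (g (2 * p + 1) * g (2 * p + 2))) * E)) := by
        rw [← c3.eq, mul_assoc X, hr, mul_assoc X]
    _ = (ascProd g (2 * p + 1) *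
          (ascProd g (2 * p) * (g (2 * p + 1) * g (2 * p + 2)))) * (X * E) := by
        rw [c4.eq]; simp only [mul_assoc]
    _ = g 1 * (ascProd g (2 * p + 2) * (ascProd g (2 * p) * (X * E))) := by
        rw [hs', hA]; simp only [mul_assoc]

lemma flip_g (h : IsBMW lam laminv del z n g gi e) {k i j : ℕ} (hk : 2 * k ≤ n) (hi : 1 ≤ i)
    (hik : i < k) (hij : i + j = 2 * k) :
    g j * (nest g k * oddProd e k) = g i * (nest g k * oddProd e k) := by
  induction k generalizing i j with
  | zero => omega
  | succ k ih =>
    rcases Nat.eq_or_lt_of_le hi with rfl | hi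
    · obtain ⟨p, rfl⟩ : ∃ p, k = p + 1 := ⟨k - 1, by omega⟩
      obtain rfl : j = 2 * p + 3 := by omega
      exact h.flip_g_one (by omega)
    · obtain ⟨i, rfl⟩ : ∃ i', i = i' + 1 := ⟨i - 1, by omega⟩
      obtain ⟨j, rfl⟩ : ∃ j', j = j' + 1 := ⟨j - 1, by omega⟩
      rw [nest_mul_oddProd_succ, ← mul_assoc, h.g_mul_ascProd (by omega) (by omega) (by omega),
        ← mul_assoc (g (i + 1)), h.g_mul_ascProd (by omega) (by omega) (by omega),
        mul_assoc (ascProd g (2 * k)) (g j), mul_assoc (ascProd g (2 * k)) (g i),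
        ← mul_assoc (g j) (nest g k * oddProd e k), ← mul_assoc (g i) (nest g k * oddProd e k),
        ih (by omega) (i := i) (j := j) (by omega) (by omega) (by omega)]

lemma flip_e_two (h : IsBMW lam laminv del z n g gi e) (hn : 3 < n) :
    e 3 * (nest g 2 * oddProd e 2) = e 1 * (nest g 2 * oddProd e 2) := by
  have hX : nest g 2 * oddProd e 2 = e 2 * (e 1 * e 3) := by
    have := h.gge 1 2 ⟨by omega, by omega, by omega, by omega, by omega⟩
    rw [← mul_assoc, ← this]
    simp [nest, oddProd, ascProd, mul_assoc]
  have hee := h.far_ee 1 3 ⟨by omega, by omega, by omega, by omega, by omega⟩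
  have h1 := h.eee 1 2 ⟨by omega, by omega, by omega, by omega, by omega⟩
  have h3 := h.eee 3 2 ⟨by omega, by omega, by omega, by omega, by omega⟩
  calc e 3 * (nest g 2 * oddProd e 2) = (e 3 * (e 2 * e 3)) * e 1 := by
        rw [hX, hee]; simp only [mul_assoc]
    _ = (e 1 * (e 2 * e 1)) * e 3 := by rw [h1, h3, hee]
    _ = e 1 * (nest g 2 * oddProd e 2) := by rw [hX]; simp only [mul_assoc]

lemma flip_e (h : IsBMW lam laminv del z n g gi e) {k i j : ℕ} (hk : 2 * k ≤ n) (hi : 1 ≤ i)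
    (hik : i < k) (hij : i + j = 2 * k) :
    e j * (nest g k * oddProd e k) = e i * (nest g k * oddProd e k) := by
  induction k generalizing i j with
  | zero => omega
  | succ k ih =>
    have shift : ∀ i j, 1 ≤ i → i < k → i + j = 2 * k →
        e (j + 1) * (nest g (k + 1) * oddProd e (k + 1)) =
          e (i + 1) * (nest g (k + 1) * oddProd e (k + 1)) := by
      intro i j hi hik hij
      rw [nest_mul_oddProd_succ, ← mul_assoc, h.e_mul_ascProd (by omega) (by omega) (by omega),
        ← mul_assoc (e (i + 1)), h.e_mul_ascProd (by omega) (by omega) (by omega),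
        mul_assoc (ascProd g (2 * k)) (e j), mul_assoc (ascProd g (2 * k)) (e i),
        ← mul_assoc (e j) (nest g k * oddProd e k), ← mul_assoc (e i) (nest g k * oddProd e k),
        ih (by omega) hi hik hij]
    rcases Nat.eq_or_lt_of_le hi with rfl | hi
    · obtain ⟨p, rfl⟩ : ∃ p, k = p + 1 := ⟨k - 1, by omega⟩
      rcases Nat.eq_zero_or_pos p with rfl | hp
      · obtain rfl : j = 3 := by omega
        exact h.flip_e_two (by omega)
      obtain rfl : j = 2 * p + 3 := by omega
      have s2 := shift 1 (2 * p + 1) le_rfl (by omega) (by omega)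
      have sg1 := h.flip_g hk (i := 1) (j := 2 * p + 3) le_rfl (by omega) (by omega)
      have sg2 := h.flip_g hk (i := 2) (j := 2 * p + 2) (by omega) (by omega) (by omega)
      simp only [Nat.reduceAdd, add_assoc] at s2 sg1 sg2 ⊢
      have mem : ∀ x ∈ ({g 1, g 2, e 1, e 2} : Set A),
          ∀ y ∈ ({g (2 * p + 2), g (2 * p + 3), e (2 * p + 2)} : Set A), x * y = y * x := by
        intro x hx y hy
        refine h.commute_gens (a := 1) (b := 3) (c := 2 * p + 2) (d := 2 * p + 4) le_rfl
          (by omega) (by omega) ?_ ?_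
        · rcases hx with rfl | rfl | rfl | rfl
          exacts [⟨1, by omega, by omega, by simp⟩, ⟨2, by omega, by omega, by simp⟩,
            ⟨1, by omega, by omega, by simp⟩, ⟨2, by omega, by omega, by simp⟩]
        · rcases hy with rfl | rfl | rfl
          exacts [⟨_, le_rfl, by omega, Or.inl rfl⟩, ⟨_, by omega, by omega, Or.inl rfl⟩,
            ⟨_, le_rfl, by omega, Or.inr (Or.inr rfl)⟩]
      have q1 := h.egg 1 2 ⟨by omega, by omega, by omega, by omega, by omega⟩
      have q2 := h.gge 2 1 ⟨by omega, by omega, by omega, by omega, by omega⟩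
      have q3 := h.gge (2 * p + 3) (2 * p + 2)
        ⟨by omega, by omega, by omega, by omega, by omega⟩
      have q4 := h.egg (2 * p + 2) (2 * p + 3)
        ⟨by omega, by omega, by omega, by omega, by omega⟩
      set X := nest g (p + 2) * oddProd e (p + 2)
      set a := g 1
      set b := g 2
      set E := e 2
      set E' := e 1
      set c := g (2 * p + 3)
      set d := g (2 * p + 2)
      set F := e (2 * p + 2)
      set F' := e (2 * p + 3)
      have hu : IsUnit (c * d) :=
        (h.isUnit_g (by omega) (by omega)).mul (h.isUnit_g (by omega) (by omega))
      refine hu.mul_left_cancel ?_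
      calc c * d * (F' * X) = (c * (d * F')) * X := by simp only [mul_assoc]
        _ = (F * (c * d)) * X := by rw [q3, q4]
        _ = F * (c * (d * X)) := by simp only [mul_assoc]
        _ = F * ((b * c) * X) := by
          rw [sg2, mem b (by simp) c (by simp)]; simp only [mul_assoc]
        _ = (b * F) * (c * X) := by rw [mem b (by simp) F (by simp)]; simp only [mul_assoc]
        _ = b * ((a * F) * X) := by
          rw [sg1, mem a (by simp) F (by simp)]; simp only [mul_assoc]
        _ = (b * (a * E)) * X := by rw [mul_assoc a, s2]; simp only [mul_assoc]
        _ = (E' * (b * a)) * X := by rw [q1, q2]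
        _ = E' * (b * (a * X)) := by simp only [mul_assoc]
        _ = E' * ((b * c) * X) := by rw [← sg1]; simp only [mul_assoc]
        _ = (E' * c) * (b * X) := by rw [mem b (by simp) c (by simp)]; simp only [mul_assoc]
        _ = c * ((E' * d) * X) := by
          rw [mem E' (by simp) c (by simp), ← sg2]; simp only [mul_assoc]
        _ = c * d * (E' * X) := by rw [mem E' (by simp) d (by simp)]; simp only [mul_assoc]
    · obtain ⟨i, rfl⟩ : ∃ i', i = i' + 1 := ⟨i - 1, by omega⟩
      obtain ⟨j, rfl⟩ : ∃ j', j = j' + 1 := ⟨j - 1, by omega⟩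
      exact shift i j (by omega) (by omega) (by omega)

lemma e_mid (h : IsBMW lam laminv del z n g gi e) {k : ℕ} (hk : 1 ≤ k) (hn : 2 * k ≤ n) :
    e k * (nest g k * oddProd e k) = del • (nest g k * oddProd e k) := by
  induction k, hk using Nat.le_induction with
  | base => simpa [nest, oddProd, ascProd] using h.e_sq 1 le_rfl (by omega)
  | succ k hk ih =>
    rw [nest_mul_oddProd_succ, ← mul_assoc, h.e_mul_ascProd hk (by omega) (by omega), mul_assoc,
      ← mul_assoc (e k), ih (by omega), smul_mul_assoc, mul_smul_comm]

lemma g_mul_e (h : IsBMW lam laminv del z n g gi e) {i j : ℕ} (hij : Adj n i j) :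
    g i * e j = gi j * (e i * e j) := by
  obtain ⟨h1, h2, h3, h4, h5⟩ := hij
  rw [← h.gge j i ⟨h3, h4, h1, h2, h5.symm⟩, ← mul_assoc (gi j), h.inv_mul j h3 h4, one_mul]

lemma g_mul_e_mul_e (h : IsBMW lam laminv del z n g gi e) {i j : ℕ} (hij : Adj n i j) :
    g i * (e j * e i) = gi j * e i := by
  rw [← mul_assoc, h.g_mul_e hij, mul_assoc, mul_assoc, h.eee i j hij]

lemma e_mul_e_mul_g (h : IsBMW lam laminv del z n g gi e) {i j : ℕ} (hij : Adj n i j) :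
    e i * (e j * g i) = e i * gi j := by
  simpa [mul_assoc] using congrArg unop (h.op.g_mul_e_mul_e hij)

lemma g_mul_e_mul_g (h : IsBMW lam laminv del z n g gi e) {i j : ℕ} (hij : Adj n i j) :
    g i * (e j * g i) = gi j * (e i * gi j) := by
  rw [← mul_assoc, h.g_mul_e hij, mul_assoc, mul_assoc, h.e_mul_e_mul_g hij]

lemma gi_mem_triple (h : IsBMW lam laminv del z n g gi e) {i : ℕ} (h1 : 1 ≤ i) (h2 : i < n) :
    gi i ∈ triple R (g i) (e i) := by
  rw [h.gi_eq h1 h2]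
  exact sub_mem (fst_mem_triple _ _) (Submodule.smul_mem _ _
    (sub_mem (snd_mem_triple _ _) (one_mem_triple _ _)))

lemma g_sq (h : IsBMW lam laminv del z n g gi e) {i : ℕ} (h1 : 1 ≤ i) (h2 : i < n) :
    g i * g i = 1 + z • (laminv • e i - g i) := by
  have h3 : g i = gi i + z • (e i - 1) := by rw [← h.skein i h1 h2]; abel
  nth_rewrite 2 [h3]
  rw [mul_add, h.mul_inv i h1 h2, mul_smul_comm, mul_sub, h.g_e i h1 h2, mul_one]

lemma triple_mul_mem (h : IsBMW lam laminv del z n g gi e) {i : ℕ} (h1 : 1 ≤ i) (h2 : i < n)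
    {x y : A} (hx : x ∈ triple R (g i) (e i)) (hy : y ∈ triple R (g i) (e i)) :
    x * y ∈ triple R (g i) (e i) := by
  have hg := fst_mem_triple (R := R) (g i) (e i)
  have he := snd_mem_triple (R := R) (g i) (e i)
  have key : ∀ c, c = 1 ∨ c = g i ∨ c = e i → c * y ∈ triple R (g i) (e i) := by
    rintro c (rfl | rfl | rfl)
    · rwa [one_mul]
    · refine triple_map_mem hy (LinearMap.mulLeft R (g i)) ?_ ?_ ?_
      · simpa using hg
      · rw [LinearMap.mulLeft_apply, h.g_sq h1 h2]
        exact add_mem (one_mem_triple _ _) (Submodule.smul_mem _ _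
          (sub_mem (Submodule.smul_mem _ _ he) hg))
      · rw [LinearMap.mulLeft_apply, h.g_e i h1 h2]
        exact Submodule.smul_mem _ _ he
    · refine triple_map_mem hy (LinearMap.mulLeft R (e i)) ?_ ?_ ?_
      · simpa using he
      · rw [LinearMap.mulLeft_apply, h.e_g i h1 h2]
        exact Submodule.smul_mem _ _ he
      · rw [LinearMap.mulLeft_apply, h.e_sq i h1 h2]
        exact Submodule.smul_mem _ _ he
  exact triple_map_mem hx (LinearMap.mulRight R y) (key _ (by simp)) (key _ (by simp))
    (key _ (by simp))

lemma triple_mul_triple_mul_triple (h : IsBMW lam laminv del z n g gi e) {i j : ℕ}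
    (hij : Adj n i j) {S : Subalgebra R A} (hg : g j ∈ S) (hgi : gi j ∈ S) (he : e j ∈ S)
    {x y w : A} (hx : x ∈ triple R (g i) (e i)) (hy : y ∈ triple R (g j) (e j))
    (hw : w ∈ triple R (g i) (e i)) :
    x * y * w ∈ S.toSubmodule * triple R (g i) (e i) * S.toSubmodule := by
  obtain ⟨hi1, hin, -⟩ := id hij
  have mem : ∀ {a c b : A}, a ∈ S → c ∈ triple R (g i) (e i) → b ∈ S →
      a * c * b ∈ S.toSubmodule * triple R (g i) (e i) * S.toSubmodule := fun ha hc hb ↦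
    Submodule.mul_mem_mul (Submodule.mul_mem_mul ha hc) hb
  have hG := fst_mem_triple (R := R) (g i) (e i)
  have hE := snd_mem_triple (R := R) (g i) (e i)
  have key : ∀ x w, (x = g i ∨ x = e i) → (w = g i ∨ w = e i) →
      x * y * w ∈ S.toSubmodule * triple R (g i) (e i) * S.toSubmodule := by
    intro x w hx hw
    have hx' : x ∈ triple R (g i) (e i) := by rcases hx with rfl | rfl <;> assumption
    have hw' : w ∈ triple R (g i) (e i) := by rcases hw with rfl | rfl <;> assumption
    refine triple_map_mem hy ((LinearMap.mulRight R w).comp (LinearMap.mulLeft R x)) ?_ ?_ ?_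
    · simpa using mem (one_mem S) (h.triple_mul_mem hi1 hin hx' hw') (one_mem S)
    · simp only [LinearMap.comp_apply, LinearMap.mulLeft_apply, LinearMap.mulRight_apply]
      rw [mul_assoc x]
      rcases hx with rfl | rfl <;> rcases hw with rfl | rfl
      · rw [h.braid i j hij, ← mul_assoc (g j)]
        exact mem hg hG hg
      · rw [h.gge i j hij]
        simpa using mem he hE (one_mem S)
      · rw [h.egg i j hij]
        simpa using mem (one_mem S) hE he
      · rw [h.ege i j hij]
        exact Submodule.smul_mem _ _ (by simpa using mem (one_mem S) hE (one_mem S))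
    · simp only [LinearMap.comp_apply, LinearMap.mulLeft_apply, LinearMap.mulRight_apply]
      rw [mul_assoc x]
      rcases hx with rfl | rfl <;> rcases hw with rfl | rfl
      · rw [h.g_mul_e_mul_g hij, ← mul_assoc (gi j)]
        exact mem hgi hE hgi
      · rw [h.g_mul_e_mul_e hij]
        simpa using mem hgi hE (one_mem S)
      · rw [h.e_mul_e_mul_g hij]
        simpa using mem (one_mem S) hE hgi
      · rw [h.eee i j hij]
        simpa using mem (one_mem S) hE (one_mem S)
  have hyS : y ∈ S := triple_le (M := S.toSubmodule) (one_mem S) hg he hy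
  have key' : ∀ x, (x = g i ∨ x = e i) →
      x * y * w ∈ S.toSubmodule * triple R (g i) (e i) * S.toSubmodule := by
    intro x hx
    have hx' : x ∈ triple R (g i) (e i) := by rcases hx with rfl | rfl <;> assumption
    refine triple_map_mem hw (LinearMap.mulLeft R (x * y)) ?_ (key _ _ hx (by simp))
      (key _ _ hx (by simp))
    simpa using mem (one_mem S) hx' hyS
  refine triple_map_mem hx (LinearMap.mulRight R w ∘ₗ LinearMap.mulRight R y) ?_
    (key' _ (by simp)) (key' _ (by simp))
  simpa using mem hyS hw (one_mem S)

lemma triple_mul_adjoin_mul_triple (h : IsBMW lam laminv del z n g gi e) {m : ℕ} (hm : 1 ≤ m)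
    (hmn : m < n)
    (hS : ∀ p, m = p + 1 → 1 ≤ p → (adjoin R (gens g gi e 1 m)).toSubmodule ≤
      (adjoin R (gens g gi e 1 p)).toSubmodule * triple R (g p) (e p) *
        (adjoin R (gens g gi e 1 p)).toSubmodule)
    {x s w : A} (hx : x ∈ triple R (g m) (e m)) (hs : s ∈ adjoin R (gens g gi e 1 m))
    (hw : w ∈ triple R (g m) (e m)) :
    x * s * w ∈ (adjoin R (gens g gi e 1 m)).toSubmodule * triple R (g m) (e m) *
      (adjoin R (gens g gi e 1 m)).toSubmodule := by
  set S := adjoin R (gens g gi e 1 m) with hSdef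
  obtain ⟨p, rfl⟩ : ∃ p, m = p + 1 := ⟨m - 1, by omega⟩
  rcases Nat.eq_zero_or_pos p with rfl | hp
  · have hempty : gens g gi e 1 (0 + 1) = ∅ :=
      Set.eq_empty_of_forall_notMem fun u ⟨i, h1, h2, _⟩ ↦ by omega
    rw [hSdef, hempty, adjoin_empty, mem_bot] at hs
    obtain ⟨r, rfl⟩ := hs
    rw [← Algebra.commutes, ← Algebra.smul_def, smul_mul_assoc]
    exact Submodule.smul_mem (S.toSubmodule * triple R (g (0 + 1)) (e (0 + 1)) * S.toSubmodule) r
      (mem_mul_mul S (h.triple_mul_mem hm hmn hx hw))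
  · refine mul_mul_le (N := (S.toSubmodule * triple R (g (p + 1)) (e (p + 1)) *
      S.toSubmodule).comap (LinearMap.mulRight R w ∘ₗ LinearMap.mulLeft R x))
      (fun a ha c hc b hb ↦ ?_) (hS p rfl hp hs)
    have hcomm : ∀ {u v : A}, u ∈ adjoin R (gens g gi e 1 p) →
        v ∈ triple R (g (p + 1)) (e (p + 1)) → Commute u v := fun hu hv ↦
      h.commute_adjoin le_rfl le_rfl (d := p + 2) (by omega) hu
        (triple_le (M := (adjoin R (gens g gi e (p + 1) (p + 2))).toSubmodule)
          (one_mem (adjoin R (gens g gi e (p + 1) (p + 2))))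
          (g_mem_adjoin le_rfl (by omega)) (e_mem_adjoin le_rfl (by omega)) hv)
    have haS : a ∈ S := adjoin_gens_mono le_rfl (by omega) ha
    have hbS : b ∈ S := adjoin_gens_mono le_rfl (by omega) hb
    have hmid := h.triple_mul_triple_mul_triple (i := p + 1) (j := p) (S := S)
      ⟨by omega, by omega, by omega, by omega, by omega⟩
      (g_mem_adjoin hp (by omega)) (gi_mem_adjoin hp (by omega)) (e_mem_adjoin hp (by omega))
      hx hc hw
    have heq : (LinearMap.mulRight R w ∘ₗ LinearMap.mulLeft R x) (a * c * b) =
        a * ((x * c * w) * b) := by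
      simp only [LinearMap.comp_apply, LinearMap.mulLeft_apply, LinearMap.mulRight_apply, mul_assoc]
      rw [(hcomm hb hw).eq, ← mul_assoc, ← (hcomm ha hx).eq, mul_assoc]
    rw [Submodule.mem_comap, heq]
    exact mul_left_mem_mul_mul haS (mul_right_mem_mul_mul hbS hmid)

lemma adjoin_gens_succ_le_of_le (h : IsBMW lam laminv del z n g gi e) {m : ℕ} (hm : 1 ≤ m)
    (hmn : m < n)
    (hS : ∀ p, m = p + 1 → 1 ≤ p → (adjoin R (gens g gi e 1 m)).toSubmodule ≤
      (adjoin R (gens g gi e 1 p)).toSubmodule * triple R (g p) (e p) *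
        (adjoin R (gens g gi e 1 p)).toSubmodule) :
    (adjoin R (gens g gi e 1 (m + 1))).toSubmodule ≤
      (adjoin R (gens g gi e 1 m)).toSubmodule * triple R (g m) (e m) *
        (adjoin R (gens g gi e 1 m)).toSubmodule := by
  set S := adjoin R (gens g gi e 1 m) with hSdef
  set N := S.toSubmodule * triple R (g m) (e m) * S.toSubmodule with hN
  have hone : (1 : A) ∈ N := mem_mul_mul S (one_mem_triple (R := R) (g m) (e m))
  have htriple : ∀ x ∈ triple R (g m) (e m), x ∈ leftStab N := by
    intro x hx y hy
    refine mul_mul_le (N := N.comap (LinearMap.mulLeft R x)) (fun a ha c hc b hb ↦ ?_) hy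
    have hmid := h.triple_mul_adjoin_mul_triple hm hmn hS hx ha hc
    rw [Submodule.mem_comap, LinearMap.mulLeft_apply, ← mul_assoc, ← mul_assoc]
    exact mul_right_mem_mul_mul hb hmid
  have hle : adjoin R (gens g gi e 1 (m + 1)) ≤ leftStab N := by
    refine adjoin_le ?_
    rintro u ⟨i, h1, h2, hu⟩
    rcases Nat.lt_succ_iff_lt_or_eq.1 h2 with hi | rfl
    · exact fun y hy ↦ mul_left_mem_mul_mul (subset_adjoin ⟨i, h1, hi, hu⟩) hy
    · rcases hu with rfl | rfl | rfl
      exacts [htriple _ (fst_mem_triple _ _), htriple _ (h.gi_mem_triple h1 hmn),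
        htriple _ (snd_mem_triple _ _)]
  intro w hw
  simpa using hle hw 1 hone

/-- `W_{m+1}` is spanned by the products `a c b` with `a, b ∈ W_m` and `c ∈ {1, g_m, e_m}`. -/
lemma adjoin_gens_succ_le (h : IsBMW lam laminv del z n g gi e) {m : ℕ} (hm : 1 ≤ m)
    (hmn : m < n) :
    (adjoin R (gens g gi e 1 (m + 1))).toSubmodule ≤
      (adjoin R (gens g gi e 1 m)).toSubmodule * triple R (g m) (e m) *
        (adjoin R (gens g gi e 1 m)).toSubmodule := by
  induction m, hm using Nat.le_induction with
  | base => exact h.adjoin_gens_succ_le_of_le le_rfl hmn (by omega)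
  | succ m hm ih =>
    refine h.adjoin_gens_succ_le_of_le (by omega) hmn fun p hp _ ↦ ?_
    obtain rfl : m = p := by omega
    exact ih (by omega)

lemma exists_flip (h : IsBMW lam laminv del z n g gi e) {k p : ℕ} (hk : 2 * k ≤ n) (hp : p ≤ k)
    {b : A} (hb : b ∈ adjoin R (gens g gi e 1 p)) :
    ∃ b' ∈ adjoin R (gens g gi e (2 * k - p + 1) (2 * k)),
      b * (nest g k * oddProd e k) = b' * (nest g k * oddProd e k) := by
  induction hb using adjoin_induction with
  | mem x hx =>
    obtain ⟨i, h1, h2, hx⟩ := hx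
    have hg := h.flip_g hk h1 (j := 2 * k - i) (by omega) (by omega)
    have he := h.flip_e hk h1 (j := 2 * k - i) (by omega) (by omega)
    rcases hx with rfl | rfl | rfl
    · exact ⟨_, g_mem_adjoin (by omega) (by omega), hg.symm⟩
    · refine ⟨_, gi_mem_adjoin (i := 2 * k - i) (by omega) (by omega), ?_⟩
      rw [h.gi_eq (by omega) (by omega), h.gi_eq (by omega) (by omega), sub_mul, sub_mul,
        smul_mul_assoc, smul_mul_assoc, sub_mul, sub_mul, hg, he]
    · exact ⟨_, e_mem_adjoin (by omega) (by omega), he.symm⟩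
  | algebraMap r => exact ⟨_, Subalgebra.algebraMap_mem _ r, rfl⟩
  | add x y _ _ hx hy =>
    obtain ⟨x', hx', hx⟩ := hx
    obtain ⟨y', hy', hy⟩ := hy
    exact ⟨x' + y', add_mem hx' hy', by rw [add_mul, add_mul, hx, hy]⟩
  | mul x y hxm _ hx hy =>
    obtain ⟨x', hx', hx⟩ := hx
    obtain ⟨y', hy', hy⟩ := hy
    refine ⟨y' * x', mul_mem hy' hx', ?_⟩
    have hc : Commute x y' := h.commute_adjoin le_rfl (by omega) hk hxm hy'
    rw [mul_assoc, hy, ← mul_assoc, hc.eq, mul_assoc, hx, mul_assoc]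

lemma mul_eq_of_mul_e_eq (h : IsBMW lam laminv del z n g gi e) {delinv : R}
    (hdel : del * delinv = 1) {k : ℕ} (hk : 1 ≤ k) (hn : 2 * k ≤ n) {u v : A}
    (huv : u * e k = v * e k) :
    u * (nest g k * oddProd e k) = v * (nest g k * oddProd e k) := by
  have hX : nest g k * oddProd e k = delinv • (e k * (nest g k * oddProd e k)) := by
    rw [h.e_mid hk hn, smul_smul, mul_comm, hdel, one_smul]
  rw [hX, mul_smul_comm, mul_smul_comm, ← mul_assoc, huv, mul_assoc v]

lemma mid_mul_mem (h : IsBMW lam laminv del z n g gi e) {delinv : R}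
    (hdel : del * delinv = 1) {p : ℕ} (hp : 1 ≤ p) (hn : 2 * (p + 1) ≤ n) {x c : A}
    (hx : x = g (p + 1) ∨ x = e (p + 1)) (hc : c ∈ triple R (g p) (e p)) :
    x * c * (nest g (p + 1) * oddProd e (p + 1)) ∈
      (adjoin R (gens g gi e 1 (p + 1))).toSubmodule.map
        (LinearMap.mulRight R (nest g (p + 1) * oddProd e (p + 1))) := by
  have hadj : Adj n (p + 1) p := ⟨by omega, by omega, by omega, by omega, by omega⟩
  have mem : ∀ {u v : A}, v ∈ adjoin R (gens g gi e 1 (p + 1)) →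
      u * e (p + 1) = v * e (p + 1) → u * (nest g (p + 1) * oddProd e (p + 1)) ∈
        (adjoin R (gens g gi e 1 (p + 1))).toSubmodule.map
          (LinearMap.mulRight R (nest g (p + 1) * oddProd e (p + 1))) := fun {u v} hv huv ↦
    ⟨v, hv, (h.mul_eq_of_mul_e_eq hdel (by omega) hn huv).symm⟩
  have hsm : ∀ r : R, r • (1 : A) ∈ adjoin R (gens g gi e 1 (p + 1)) := fun r ↦
    Subalgebra.smul_mem _ (one_mem _) r
  refine triple_map_mem hc
    (LinearMap.mulRight R (nest g (p + 1) * oddProd e (p + 1)) ∘ₗ LinearMap.mulLeft R x)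
    ?_ ?_ ?_ <;> simp only [LinearMap.comp_apply, LinearMap.mulLeft_apply,
      LinearMap.mulRight_apply] <;> rcases hx with rfl | rfl
  · exact mem (hsm laminv) (by rw [mul_one, h.g_e _ (by omega) (by omega), smul_mul_assoc, one_mul])
  · exact mem (hsm del) (by rw [mul_one, h.e_sq _ (by omega) (by omega), smul_mul_assoc, one_mul])
  · exact mem (e_mem_adjoin hp (by omega)) (by rw [mul_assoc, h.gge _ _ hadj])
  · exact mem (hsm lam) (by rw [mul_assoc, h.ege _ _ hadj, smul_mul_assoc, one_mul])
  · exact mem (gi_mem_adjoin hp (by omega)) (by rw [mul_assoc, h.g_mul_e_mul_e hadj])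
  · exact mem (one_mem _) (by rw [mul_assoc, h.eee _ _ hadj, one_mul])

lemma mid_mul_adjoin_mem (h : IsBMW lam laminv del z n g gi e) {delinv : R}
    (hdel : del * delinv = 1) {k : ℕ} (hk : 1 ≤ k) (hn : 2 * k ≤ n) {x s : A}
    (hx : x = g k ∨ x = e k) (hs : s ∈ adjoin R (gens g gi e 1 k)) :
    x * (s * (nest g k * oddProd e k)) ∈ (adjoin R (gens g gi e 1 k)).toSubmodule.map
        (LinearMap.mulRight R (nest g k * oddProd e k)) := by
  obtain ⟨p, rfl⟩ : ∃ p, k = p + 1 := ⟨k - 1, by omega⟩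
  rcases Nat.eq_zero_or_pos p with rfl | hp
  · have hempty : gens g gi e 1 (0 + 1) = ∅ :=
      Set.eq_empty_of_forall_notMem fun u ⟨i, h1, h2, _⟩ ↦ by omega
    rw [hempty, adjoin_empty, mem_bot] at hs
    obtain ⟨r, rfl⟩ := hs
    rw [← Algebra.smul_def, mul_smul_comm]
    refine Submodule.smul_mem _ _ ?_
    rcases hx with rfl | rfl
    · exact ⟨laminv • 1, Subalgebra.smul_mem _ (one_mem _) _,
        (h.mul_eq_of_mul_e_eq hdel le_rfl hn (by
          rw [h.g_e _ le_rfl (by omega), smul_mul_assoc, one_mul])).symm⟩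
    · exact ⟨del • 1, Subalgebra.smul_mem _ (one_mem _) _,
        (h.mul_eq_of_mul_e_eq hdel le_rfl hn (by
          rw [h.e_sq _ le_rfl (by omega), smul_mul_assoc, one_mul])).symm⟩
  · set X := nest g (p + 1) * oddProd e (p + 1) with hX
    refine mul_mul_le (N := ((adjoin R (gens g gi e 1 (p + 1))).toSubmodule.map
        (LinearMap.mulRight R X)).comap (LinearMap.mulLeft R x ∘ₗ LinearMap.mulRight R X))
      (fun a ha c hc b hb ↦ ?_) (h.adjoin_gens_succ_le hp (by omega) hs)
    obtain ⟨b', hb', hbb⟩ := h.exists_flip hn (by omega) hb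
    obtain ⟨v, hv, hxv⟩ := h.mid_mul_mem hdel hp hn hx hc
    rw [LinearMap.mulRight_apply, ← hX] at hxv
    rw [← hX] at hbb
    have hxm : x ∈ adjoin R (gens g gi e (p + 1) (p + 2)) := by
      rcases hx with rfl | rfl
      exacts [g_mem_adjoin le_rfl (by omega), e_mem_adjoin le_rfl (by omega)]
    have hcm : c ∈ adjoin R (gens g gi e 1 (p + 1)) :=
      triple_le (M := (adjoin R (gens g gi e 1 (p + 1))).toSubmodule)
        (one_mem (adjoin R (gens g gi e 1 (p + 1))))
        (g_mem_adjoin hp (by omega)) (e_mem_adjoin hp (by omega)) hc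
    have c1 : Commute a x := h.commute_adjoin le_rfl le_rfl (by omega) ha hxm
    have c2 : Commute (x * c) b' := h.commute_adjoin le_rfl (by omega) hn
      (mul_mem (adjoin_gens_mono (by omega) le_rfl hxm)
        (adjoin_gens_mono le_rfl (by omega) hcm)) hb'
    have c3 : Commute v b' := h.commute_adjoin (b := p + 2) le_rfl (by omega) hn
      (adjoin_gens_mono le_rfl (by omega) hv) hb'
    refine ⟨a * v * b, Subalgebra.mul_mem _ (Subalgebra.mul_mem _
      (adjoin_gens_mono le_rfl (by omega) ha) hv) (adjoin_gens_mono le_rfl (by omega) hb), ?_⟩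
    simp only [LinearMap.comp_apply, LinearMap.mulLeft_apply, LinearMap.mulRight_apply]
    calc a * v * b * X = a * ((v * b') * X) := by rw [mul_assoc, hbb]; simp only [mul_assoc]
      _ = a * (b' * (x * c * X)) := by rw [c3.eq, mul_assoc, hxv]
      _ = a * ((x * c * b') * X) := by rw [c2.eq]; simp only [mul_assoc]
      _ = (a * x) * (c * (b' * X)) := by simp only [mul_assoc]
      _ = x * (a * c * b * X) := by rw [c1.eq, ← hbb]; simp only [mul_assoc]

/-- Every element acts on the nested element `nest g k * oddProd e k` as an element of `W_k`. -/
lemma exists_mul_eq (h : IsBMW lam laminv del z n g gi e) {delinv : R}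
    (hdel : del * delinv = 1) {k : ℕ} (hk : 1 ≤ k) (hn : 2 * k ≤ n) {w : A}
    (hw : w ∈ adjoin R (gens g gi e 1 (2 * k))) :
    ∃ a ∈ adjoin R (gens g gi e 1 k),
      w * (nest g k * oddProd e k) = a * (nest g k * oddProd e k) := by
  set X := nest g k * oddProd e k with hX
  set S := adjoin R (gens g gi e 1 k) with hS
  set M := S.toSubmodule.map (LinearMap.mulRight R X) with hM
  have mem : ∀ i, 1 ≤ i → i < 2 * k → ∀ x y : A, (x = g i ∧ y = g (2 * k - i) ∨
      x = e i ∧ y = e (2 * k - i)) → x ∈ leftStab M := by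
    rintro i h1 h2 x y hxy _ ⟨s, hs, rfl⟩
    rw [LinearMap.mulRight_apply]
    have hx : x ∈ adjoin R (gens g gi e i (i + 1)) := by
      rcases hxy with ⟨rfl, -⟩ | ⟨rfl, -⟩
      exacts [g_mem_adjoin le_rfl (by omega), e_mem_adjoin le_rfl (by omega)]
    rcases lt_trichotomy i k with hik | rfl | hik
    · exact ⟨x * s, S.mul_mem (adjoin_gens_mono h1 (by omega) hx) hs, mul_assoc _ _ _⟩
    · exact h.mid_mul_adjoin_mem hdel hk hn (hxy.imp And.left And.left) hs
    · have hy : y ∈ S := by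
        rcases hxy with ⟨-, rfl⟩ | ⟨-, rfl⟩
        exacts [g_mem_adjoin (by omega) (by omega), e_mem_adjoin (by omega) (by omega)]
      have hc : Commute s x := h.commute_adjoin le_rfl (by omega) (by omega) hs hx
      have hxX : x * X = y * X := by
        rcases hxy with ⟨rfl, rfl⟩ | ⟨rfl, rfl⟩
        exacts [h.flip_g hn (by omega) (by omega) (by omega),
          h.flip_e hn (by omega) (by omega) (by omega)]
      refine ⟨s * y, S.mul_mem hs hy, ?_⟩
      rw [LinearMap.mulRight_apply, mul_assoc, ← hxX, ← mul_assoc, hc.eq, mul_assoc]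
  have hle : adjoin R (gens g gi e 1 (2 * k)) ≤ leftStab M := by
    refine adjoin_le ?_
    rintro _ ⟨i, h1, h2, rfl | rfl | rfl⟩
    · exact mem i h1 h2 _ _ (Or.inl ⟨rfl, rfl⟩)
    · rw [h.gi_eq h1 (by omega)]
      exact sub_mem (mem i h1 h2 _ _ (Or.inl ⟨rfl, rfl⟩)) (Subalgebra.smul_mem _
        (sub_mem (mem i h1 h2 _ _ (Or.inr ⟨rfl, rfl⟩)) (one_mem _)) _)
    · exact mem i h1 h2 _ _ (Or.inr ⟨rfl, rfl⟩)
  obtain ⟨a, ha, hwa⟩ := hle hw X ⟨1, one_mem S, one_mul X⟩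
  exact ⟨a, ha, hwa.symm⟩

lemma oddProd_op (h : IsBMW lam laminv del z n g gi e) {k : ℕ} (hk : 2 * k ≤ n) :
    oddProd (fun i ↦ MulOpposite.op (e i)) k = MulOpposite.op (oddProd e k) := by
  induction k with
  | zero => rfl
  | succ k ih =>
    have hc : Commute (oddProd e k) (e (2 * k + 1)) := h.commute_adjoin le_rfl le_rfl hk
      (oddProd_mem (R := R) (g := g) (gi := gi) k) (e_mem_adjoin le_rfl (by omega))
    rw [oddProd, oddProd, ih (by omega), ← op_mul, hc.eq]

lemma commute_unop_nest (h : IsBMW lam laminv del z n g gi e) {k : ℕ} (hk : 2 * (k + 1) ≤ n) :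
    Commute (unop (nest (fun i ↦ MulOpposite.op (g i)) k)) (e (2 * k + 1)) := by
  have hc : Commute (nest (fun i ↦ MulOpposite.op (g i)) k) (MulOpposite.op (e (2 * k + 1))) :=
    h.op.commute_adjoin le_rfl le_rfl hk (nest_mem k) (e_mem_adjoin le_rfl (by omega))
  exact hc.unop

/-- Left multiplication on `f_k` factors through `W_k`. -/
lemma exists_mul_eq_mul_nest (h : IsBMW lam laminv del z n g gi e) {delinv : R}
    (hdel : del * delinv = 1) {k : ℕ} (hk : 1 ≤ k) (hn : 2 * k ≤ n) {w : A}
    (hw : w ∈ adjoin R (gens g gi e 1 (2 * k))) :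
    ∃ a ∈ adjoin R (gens g gi e 1 k),
      w * (nest g k * oddProd e k * unop (nest (fun i ↦ MulOpposite.op (g i)) k)) =
        a * (nest g k * oddProd e k * unop (nest (fun i ↦ MulOpposite.op (g i)) k)) := by
  obtain ⟨a, ha, hwa⟩ := h.exists_mul_eq hdel hk hn hw
  exact ⟨a, ha, by rw [← mul_assoc, hwa, mul_assoc]⟩

lemma op_mem_adjoin_gens {a b : ℕ} {w : A} :
    MulOpposite.op w ∈ adjoin R (gens (fun i ↦ MulOpposite.op (g i))
      (fun i ↦ MulOpposite.op (gi i)) (fun i ↦ MulOpposite.op (e i)) a b) ↔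
      w ∈ adjoin R (gens g gi e a b) := by
  have hset : gens (fun i ↦ MulOpposite.op (g i)) (fun i ↦ MulOpposite.op (gi i))
      (fun i ↦ MulOpposite.op (e i)) a b = unop ⁻¹' gens g gi e a b := by
    ext x
    simp [gens, ← unop_inj]
  rw [hset, ← Subalgebra.op_adjoin, Subalgebra.mem_op, unop_op]

/-- Right multiplication on `f_k` factors through `W_k`. -/
lemma exists_mul_nest_eq (h : IsBMW lam laminv del z n g gi e) {delinv : R}
    (hdel : del * delinv = 1) {k : ℕ} (hk : 1 ≤ k) (hn : 2 * k ≤ n) {w : A}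
    (hw : w ∈ adjoin R (gens g gi e 1 (2 * k))) :
    ∃ a ∈ adjoin R (gens g gi e 1 k),
      (nest g k * oddProd e k * unop (nest (fun i ↦ MulOpposite.op (g i)) k)) * w =
        (nest g k * oddProd e k * unop (nest (fun i ↦ MulOpposite.op (g i)) k)) * a := by
  obtain ⟨a, ha, hwa⟩ := h.op.exists_mul_eq hdel hk hn (op_mem_adjoin_gens.2 hw)
  refine ⟨unop a, op_mem_adjoin_gens.1 ha, ?_⟩
  rw [h.oddProd_op hn] at hwa
  have hwa' := congrArg unop hwa
  simp only [unop_mul, unop_op] at hwa'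
  rw [mul_assoc (nest g k), mul_assoc, hwa', ← mul_assoc]

end IsBMW

section ideals

variable {R A : Type*} [CommRing R] [Ring A] [Algebra R A] {W : Subalgebra R A} {f : A}

lemma span_mul_eq (hL : ∀ w, ∃ a ∈ W, w * f = a * f) :
    Submodule.span R {y : A | ∃ w, y = w * f} =
      Submodule.span R {y : A | ∃ a ∈ W, y = a * f} := by
  congr 1
  ext y
  refine ⟨?_, fun ⟨a, _, hy⟩ ↦ ⟨a, hy⟩⟩
  rintro ⟨w, rfl⟩
  exact hL w

lemma span_mul_eq' (hR : ∀ w, ∃ a ∈ W, f * w = f * a) :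
    Submodule.span R {y : A | ∃ w, y = f * w} =
      Submodule.span R {y : A | ∃ a ∈ W, y = f * a} := by
  congr 1
  ext y
  refine ⟨?_, fun ⟨a, _, hy⟩ ↦ ⟨a, hy⟩⟩
  rintro ⟨w, rfl⟩
  exact hR w

lemma twoSidedIdeal_span_mul_mul {u v o : A} (hu : IsUnit u) (hv : IsUnit v) :
    TwoSidedIdeal.span {o} = TwoSidedIdeal.span {u * o * v} := by
  obtain ⟨u, rfl⟩ := hu
  obtain ⟨v, rfl⟩ := hv
  have le : ∀ {x y a b : A}, x = a * y * b → TwoSidedIdeal.span {x} ≤ TwoSidedIdeal.span {y} := by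
    rintro _ y a b rfl
    refine TwoSidedIdeal.span_le.2 (Set.singleton_subset_iff.2 ?_)
    exact TwoSidedIdeal.mul_mem_right _ _ _ (TwoSidedIdeal.mul_mem_left _ _ _
      (TwoSidedIdeal.subset_span rfl))
  exact le_antisymm (le (a := ↑u⁻¹) (b := ↑v⁻¹) (by simp [mul_assoc])) (le rfl)

lemma mem_twoSidedIdeal_span_iff (hL : ∀ w, ∃ a ∈ W, w * f = a * f)
    (hR : ∀ w, ∃ a ∈ W, f * w = f * a) (y : A) :
    y ∈ TwoSidedIdeal.span {f} ↔
      y ∈ Submodule.span R {t : A | ∃ a ∈ W, ∃ b ∈ W, t = a * f * b} := by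
  set M := Submodule.span R {t : A | ∃ a ∈ W, ∃ b ∈ W, t = a * f * b} with hM
  have hl : ∀ x y : A, y ∈ M → x * y ∈ M := by
    intro x y hy
    refine (Submodule.span_le.2 ?_ : M ≤ M.comap (LinearMap.mulLeft R x)) hy
    rintro _ ⟨a, _, b, hb, rfl⟩
    obtain ⟨c, hc, hca⟩ := hL (x * a)
    refine Submodule.subset_span ⟨c, hc, b, hb, ?_⟩
    rw [LinearMap.mulLeft_apply, ← hca]
    simp only [mul_assoc]
  have hr : ∀ x y : A, x ∈ M → x * y ∈ M := by
    intro x y hx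
    refine (Submodule.span_le.2 ?_ : M ≤ M.comap (LinearMap.mulRight R y)) hx
    rintro _ ⟨a, ha, b, _, rfl⟩
    obtain ⟨c, hc, hbc⟩ := hR (b * y)
    refine Submodule.subset_span ⟨a, ha, c, hc, ?_⟩
    rw [LinearMap.mulRight_apply, mul_assoc, mul_assoc, hbc, ← mul_assoc]
  constructor
  · intro hy
    have hle : TwoSidedIdeal.span {f} ≤ TwoSidedIdeal.mk' (M : Set A) M.zero_mem M.add_mem
        M.neg_mem (hl _ _) (hr _ _) := by
      refine TwoSidedIdeal.span_le.2 (Set.singleton_subset_iff.2 ?_)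
      rw [SetLike.mem_coe, TwoSidedIdeal.mem_mk']
      exact Submodule.subset_span ⟨1, one_mem W, 1, one_mem W, by simp⟩
    simpa using hle hy
  · intro hy
    induction hy using Submodule.span_induction with
    | mem x hx =>
      obtain ⟨a, _, b, _, rfl⟩ := hx
      exact TwoSidedIdeal.mul_mem_right _ _ _ (TwoSidedIdeal.mul_mem_left _ _ _
        (TwoSidedIdeal.subset_span rfl))
    | zero => exact TwoSidedIdeal.zero_mem _
    | add x y _ _ hx hy => exact TwoSidedIdeal.add_mem _ hx hy
    | smul r x _ hx =>
      rw [Algebra.smul_def]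
      exact TwoSidedIdeal.mul_mem_left _ _ _ hx

end ideals

section presentation

variable (R : Type*) [CommRing R] (lam laminv del z : R) (n : ℕ)

lemma isBMW : IsBMW lam laminv del z n (g R lam laminv del z n) (gi R lam laminv del z n)
    (e R lam laminv del z n) := by
  have rel : ∀ {x y}, Rel R lam laminv del z n x y →
      RingQuot.mkAlgHom R (Rel R lam laminv del z n) x =
        RingQuot.mkAlgHom R (Rel R lam laminv del z n) y := RingQuot.mkAlgHom_rel R
  constructor
  · intro i h1 h2
    simpa [g, gi] using rel (.inv_right i ⟨h1, h2⟩)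
  · intro i h1 h2
    simpa [g, gi] using rel (.inv_left i ⟨h1, h2⟩)
  · intro i h1 h2
    simpa [e] using rel (.idem i ⟨h1, h2⟩)
  · rintro i j ⟨h1, h2, h3, h4, rfl | rfl⟩
    · simpa [g, mul_assoc] using rel (.braid i ⟨h1, h4⟩)
    · simpa [g, mul_assoc] using (rel (.braid j ⟨h3, h2⟩)).symm
  · rintro i j ⟨h1, h2, h3, h4, h5⟩
    simpa [g] using rel (.comm_gg i j ⟨h1, h3, h2, h4, h5⟩)
  · rintro i j ⟨h1, h2, h3, h4, h5⟩
    simpa [g, e] using rel (.comm_ge i j ⟨h1, h3, h2, h4, h5⟩)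
  · rintro i j ⟨h1, h2, h3, h4, h5⟩
    simpa [e] using rel (.comm_ee i j ⟨h1, h3, h2, h4, h5⟩)
  · rintro i j ⟨h1, h2, h3, h4, rfl | rfl⟩
    · simpa [e, mul_assoc] using rel (.tangle_eee_up i ⟨h1, h4⟩)
    · simpa [e, mul_assoc] using rel (.tangle_eee_down j ⟨h3, h2⟩)
  · rintro i j ⟨h1, h2, h3, h4, rfl | rfl⟩
    · simpa [g, e, mul_assoc] using rel (.tangle_gge_up i ⟨h1, h4⟩)
    · simpa [g, e, mul_assoc] using rel (.tangle_gge_down j ⟨h3, h2⟩)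
  · rintro i j ⟨h1, h2, h3, h4, rfl | rfl⟩
    · simpa [g, e, mul_assoc] using rel (.tangle_egg_up i ⟨h1, h4⟩)
    · simpa [g, e, mul_assoc] using rel (.tangle_egg_down j ⟨h3, h2⟩)
  · intro i h1 h2
    simpa [g, gi, e] using rel (.skein i ⟨h1, h2⟩)
  · intro i h1 h2
    simpa [g, e] using rel (.untwist_ge i ⟨h1, h2⟩)
  · intro i h1 h2
    simpa [g, e] using rel (.untwist_eg i ⟨h1, h2⟩)
  · rintro i j ⟨h1, h2, h3, h4, rfl | rfl⟩
    · simpa [g, e, mul_assoc] using rel (.untwist_ege_up i ⟨h1, h4⟩)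
    · simpa [g, e, mul_assoc] using rel (.untwist_ege_down j ⟨h3, h2⟩)

lemma gasc_eq (m : ℕ) : gasc R lam laminv del z n m = ascProd (g R lam laminv del z n) m := by
  induction m with
  | zero => rfl
  | succ m ih => rw [gasc, ascProd, ih]

lemma gdesc_eq (m : ℕ) : gdesc R lam laminv del z n m =
    unop (ascProd (fun i ↦ op (g R lam laminv del z n i)) m) := by
  induction m with
  | zero => rfl
  | succ m ih => rw [gdesc, ascProd, ih, unop_mul, unop_op]

lemma eodd_eq (k : ℕ) : eodd R lam laminv del z n k = oddProd (e R lam laminv del z n) k := by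
  induction k with
  | zero => rfl
  | succ k ih => rw [eodd, oddProd, ih]

lemma fk_eq {k : ℕ} (hk : 2 * k ≤ n) : fk R lam laminv del z n k =
    nest (g R lam laminv del z n) k * oddProd (e R lam laminv del z n) k *
      unop (nest (fun i ↦ op (g R lam laminv del z n i)) k) := by
  match k with
  | 0 => simp [fk, nest, oddProd]
  | 1 => simp [fk, nest, oddProd, ascProd]
  | k + 2 =>
    have hc := (isBMW R lam laminv del z n).commute_unop_nest (k := k + 1) (by omega)
    have hV : unop (nest (fun i ↦ op (g R lam laminv del z n i)) (k + 2)) =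
        unop (nest (fun i ↦ op (g R lam laminv del z n i)) (k + 1)) *
          unop (ascProd (fun i ↦ op (g R lam laminv del z n i)) (2 * (k + 1))) := rfl
    have key : ∀ a x v c u : Alg R lam laminv del z n, Commute v c →
        a * (x * v) * c * u = a * (x * c) * (v * u) := fun a x v c u huv ↦ by
      simp only [mul_assoc]
      rw [← mul_assoc v, huv.eq, mul_assoc]
    rw [fk, gasc_eq, gdesc_eq, fk_eq (by omega), nest_mul_oddProd_succ _ _ (k + 1), hV]
    exact key _ _ _ _ _ hc

lemma adjoin_gens_eq_top : adjoin R (gens (g R lam laminv del z n) (gi R lam laminv del z n)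
    (e R lam laminv del z n) 1 n) = ⊤ := by
  rw [_root_.eq_top_iff]
  intro w _
  obtain ⟨x, rfl⟩ := RingQuot.mkAlgHom_surjective R (Rel R lam laminv del z n) w
  induction x using FreeAlgebra.induction with
  | grade0 r => rw [AlgHom.commutes]; exact Subalgebra.algebraMap_mem _ r
  | grade1 x =>
    refine subset_adjoin ?_
    cases x with
    | g i h => exact ⟨i, h.1, h.2, Or.inl (by rw [g, FG, dif_pos h])⟩
    | gi i h => exact ⟨i, h.1, h.2, Or.inr (Or.inl (by rw [gi, FGi, dif_pos h]))⟩
    | e i h => exact ⟨i, h.1, h.2, Or.inr (Or.inr (by rw [e, FE, dif_pos h]))⟩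
  | mul x y hx hy => rw [map_mul]; exact mul_mem (hx trivial) (hy trivial)
  | add x y hx hy => rw [map_add]; exact add_mem (hx trivial) (hy trivial)

end presentation

end BMW

namespace BMW

/-- In `W_{2k,R}` (`k ≥ 1`), with `W_k` the subalgebra generated by
`{g_i, g_i⁻¹, e_i : 1 ≤ i ≤ k-1}`:
(1) `W_{2k,R} f_k = W_k f_k` and `f_k W_{2k,R} = f_k W_k` (as spans);
(2) the two-sided ideal generated by `e_1 e_3 ⋯ e_{2k-1}` equals the two-sided ideal
generated by `f_k`, and equals the `R`-submodule spanned by `{a f_k b : a, b ∈ W_k}`. -/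
theorem fk_ideals
    (R : Type*) [CommRing R] (lam laminv del delinv z : R)
    (hlam : lam * laminv = 1) (hdel : del * delinv = 1)
    (hskein : laminv - lam = z * (del - 1)) (k : ℕ) (hk : 1 ≤ k) :
    (Submodule.span R
        {y : Alg R lam laminv del z (2 * k) | ∃ w : Alg R lam laminv del z (2 * k),
          y = w * fk R lam laminv del z (2 * k) k} =
      Submodule.span R
        {y : Alg R lam laminv del z (2 * k) |
          ∃ a ∈ Algebra.adjoin R
            {u : Alg R lam laminv del z (2 * k) | ∃ i : ℕ, 1 ≤ i ∧ i < k ∧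
              (u = g R lam laminv del z (2 * k) i ∨ u = gi R lam laminv del z (2 * k) i ∨
                u = e R lam laminv del z (2 * k) i)},
          y = a * fk R lam laminv del z (2 * k) k}) ∧
    (Submodule.span R
        {y : Alg R lam laminv del z (2 * k) | ∃ w : Alg R lam laminv del z (2 * k),
          y = fk R lam laminv del z (2 * k) k * w} =
      Submodule.span R
        {y : Alg R lam laminv del z (2 * k) |
          ∃ a ∈ Algebra.adjoin R
            {u : Alg R lam laminv del z (2 * k) | ∃ i : ℕ, 1 ≤ i ∧ i < k ∧
              (u = g R lam laminv del z (2 * k) i ∨ u = gi R lam laminv del z (2 * k) i ∨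
                u = e R lam laminv del z (2 * k) i)},
          y = fk R lam laminv del z (2 * k) k * a}) ∧
    (TwoSidedIdeal.span {eodd R lam laminv del z (2 * k) k} =
      TwoSidedIdeal.span {fk R lam laminv del z (2 * k) k}) ∧
    (∀ y : Alg R lam laminv del z (2 * k),
      y ∈ TwoSidedIdeal.span {fk R lam laminv del z (2 * k) k} ↔
      y ∈ Submodule.span R
        {t : Alg R lam laminv del z (2 * k) |
          ∃ a ∈ Algebra.adjoin R
            {u : Alg R lam laminv del z (2 * k) | ∃ i : ℕ, 1 ≤ i ∧ i < k ∧
              (u = g R lam laminv del z (2 * k) i ∨ u = gi R lam laminv del z (2 * k) i ∨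
                u = e R lam laminv del z (2 * k) i)},
          ∃ b ∈ Algebra.adjoin R
            {u : Alg R lam laminv del z (2 * k) | ∃ i : ℕ, 1 ≤ i ∧ i < k ∧
              (u = g R lam laminv del z (2 * k) i ∨ u = gi R lam laminv del z (2 * k) i ∨
                u = e R lam laminv del z (2 * k) i)},
          t = a * fk R lam laminv del z (2 * k) k * b}) := by
  have h := isBMW R lam laminv del z (2 * k)
  have htop : ∀ w, w ∈ Algebra.adjoin R (gens (g R lam laminv del z (2 * k))
      (gi R lam laminv del z (2 * k)) (e R lam laminv del z (2 * k)) 1 (2 * k)) := fun w ↦ by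
    rw [adjoin_gens_eq_top]; trivial
  have hf := fk_eq R lam laminv del z (2 * k) (k := k) le_rfl
  have hL : ∀ w, ∃ a ∈ Algebra.adjoin R (gens (g R lam laminv del z (2 * k))
      (gi R lam laminv del z (2 * k)) (e R lam laminv del z (2 * k)) 1 k),
      w * fk R lam laminv del z (2 * k) k = a * fk R lam laminv del z (2 * k) k := fun w ↦ by
    rw [hf]; exact h.exists_mul_eq_mul_nest hdel hk le_rfl (htop w)
  have hR : ∀ w, ∃ a ∈ Algebra.adjoin R (gens (g R lam laminv del z (2 * k))
      (gi R lam laminv del z (2 * k)) (e R lam laminv del z (2 * k)) 1 k),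
      fk R lam laminv del z (2 * k) k * w = fk R lam laminv del z (2 * k) k * a := fun w ↦ by
    rw [hf]; exact h.exists_mul_nest_eq hdel hk le_rfl (htop w)
  refine ⟨span_mul_eq hL, span_mul_eq' hR, ?_, mem_twoSidedIdeal_span_iff hL hR⟩
  rw [hf, eodd_eq]
  exact twoSidedIdeal_span_mul_mul (h.isUnit_nest le_rfl) (h.op.isUnit_nest le_rfl).unop

end BMW
end

section
/- In Ŵ_{n+1,S}, for every n ≥ 1 and every integer r ≥ 1: (1) g_n x_n g_n x_n = x_n g_n x_n g_n; (2) e_n x_n g_n x_n = λ⁻¹ e_n; (3) e_n x_n^r g_n x_n = λ⁻² e_n x_n^{r−1} g_n⁻¹; (4) e_n x_n^{−r} g_n⁻¹ x_n⁻¹ = λ² e_n x_n^{−r+1} g_n. -/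
namespace ABMW

/-- Generators of the affine Birman–Wenzl–Murakami algebra `Ŵ_{n,S}`:
`x₁`, `x₁⁻¹` and `g i`, `g i⁻¹`, `e i` for `1 ≤ i ≤ n - 1`. -/
inductive Gen (n : ℕ) : Type where
  | x : Gen n
  | xi : Gen n
  | g (i : ℕ) (h : 1 ≤ i ∧ i < n) : Gen n
  | gi (i : ℕ) (h : 1 ≤ i ∧ i < n) : Gen n
  | e (i : ℕ) (h : 1 ≤ i ∧ i < n) : Gen n

variable (S : Type*) [CommRing S]

/-- The generator `x₁` in the free algebra. -/
noncomputable def FX (n : ℕ) : FreeAlgebra S (Gen n) := FreeAlgebra.ι S Gen.x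

/-- The generator `x₁⁻¹` in the free algebra. -/
noncomputable def FXi (n : ℕ) : FreeAlgebra S (Gen n) := FreeAlgebra.ι S Gen.xi

/-- The generator `g i` in the free algebra (junk value `1` if `i` is out of range). -/
noncomputable def FG (n i : ℕ) : FreeAlgebra S (Gen n) :=
  if h : 1 ≤ i ∧ i < n then FreeAlgebra.ι S (Gen.g i h) else 1

/-- The generator `g i⁻¹` in the free algebra (junk value `1` if `i` is out of range). -/
noncomputable def FGi (n i : ℕ) : FreeAlgebra S (Gen n) :=
  if h : 1 ≤ i ∧ i < n then FreeAlgebra.ι S (Gen.gi i h) else 1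

/-- The generator `e i` in the free algebra (junk value `1` if `i` is out of range). -/
noncomputable def FE (n i : ℕ) : FreeAlgebra S (Gen n) :=
  if h : 1 ≤ i ∧ i < n then FreeAlgebra.ι S (Gen.e i h) else 1

/-- The defining relations of the affine Birman–Wenzl–Murakami algebra `Ŵ_{n,S}`. -/
inductive Rel (lam laminv del z : S) (q : ℕ → S) (n : ℕ) :
    FreeAlgebra S (Gen n) → FreeAlgebra S (Gen n) → Prop where
  -- (1) inverses
  | inv_right (i : ℕ) (h : 1 ≤ i ∧ i < n) :
      Rel lam laminv del z q n (FG S n i * FGi S n i) 1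
  | inv_left (i : ℕ) (h : 1 ≤ i ∧ i < n) :
      Rel lam laminv del z q n (FGi S n i * FG S n i) 1
  | xinv_right : Rel lam laminv del z q n (FX S n * FXi S n) 1
  | xinv_left : Rel lam laminv del z q n (FXi S n * FX S n) 1
  -- (2) idempotent relation
  | idem (i : ℕ) (h : 1 ≤ i ∧ i < n) :
      Rel lam laminv del z q n (FE S n i * FE S n i) (del • FE S n i)
  -- (3) affine braid relations
  | braid (i : ℕ) (h : 1 ≤ i ∧ i + 1 < n) :
      Rel lam laminv del z q n (FG S n i * FG S n (i + 1) * FG S n i)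
        (FG S n (i + 1) * FG S n i * FG S n (i + 1))
  | comm_gg (i j : ℕ) (h : 1 ≤ i ∧ 1 ≤ j ∧ i < n ∧ j < n ∧ (i + 2 ≤ j ∨ j + 2 ≤ i)) :
      Rel lam laminv del z q n (FG S n i * FG S n j) (FG S n j * FG S n i)
  | xbraid (h : 1 < n) :
      Rel lam laminv del z q n (FX S n * FG S n 1 * FX S n * FG S n 1)
        (FG S n 1 * FX S n * FG S n 1 * FX S n)
  | comm_xg (j : ℕ) (h : 2 ≤ j ∧ j < n) :
      Rel lam laminv del z q n (FX S n * FG S n j) (FG S n j * FX S n)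
  -- (4) commutation relations
  | comm_ge (i j : ℕ) (h : 1 ≤ i ∧ 1 ≤ j ∧ i < n ∧ j < n ∧ (i + 2 ≤ j ∨ j + 2 ≤ i)) :
      Rel lam laminv del z q n (FG S n i * FE S n j) (FE S n j * FG S n i)
  | comm_ee (i j : ℕ) (h : 1 ≤ i ∧ 1 ≤ j ∧ i < n ∧ j < n ∧ (i + 2 ≤ j ∨ j + 2 ≤ i)) :
      Rel lam laminv del z q n (FE S n i * FE S n j) (FE S n j * FE S n i)
  | comm_xe (j : ℕ) (h : 2 ≤ j ∧ j < n) :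
      Rel lam laminv del z q n (FX S n * FE S n j) (FE S n j * FX S n)
  -- (5) affine tangle relations
  | tangle_eee_up (i : ℕ) (h : 1 ≤ i ∧ i + 1 < n) :
      Rel lam laminv del z q n (FE S n i * FE S n (i + 1) * FE S n i) (FE S n i)
  | tangle_eee_down (i : ℕ) (h : 1 ≤ i ∧ i + 1 < n) :
      Rel lam laminv del z q n (FE S n (i + 1) * FE S n i * FE S n (i + 1)) (FE S n (i + 1))
  | tangle_gge_up (i : ℕ) (h : 1 ≤ i ∧ i + 1 < n) :
      Rel lam laminv del z q n (FG S n i * FG S n (i + 1) * FE S n i)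
        (FE S n (i + 1) * FE S n i)
  | tangle_gge_down (i : ℕ) (h : 1 ≤ i ∧ i + 1 < n) :
      Rel lam laminv del z q n (FG S n (i + 1) * FG S n i * FE S n (i + 1))
        (FE S n i * FE S n (i + 1))
  | tangle_egg_up (i : ℕ) (h : 1 ≤ i ∧ i + 1 < n) :
      Rel lam laminv del z q n (FE S n i * FG S n (i + 1) * FG S n i)
        (FE S n i * FE S n (i + 1))
  | tangle_egg_down (i : ℕ) (h : 1 ≤ i ∧ i + 1 < n) :
      Rel lam laminv del z q n (FE S n (i + 1) * FG S n i * FG S n (i + 1))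
        (FE S n (i + 1) * FE S n i)
  | tangle_q (r : ℕ) (hr : 1 ≤ r) (h : 1 < n) :
      Rel lam laminv del z q n (FE S n 1 * FX S n ^ r * FE S n 1) (q r • FE S n 1)
  -- (6) Kauffman skein relation
  | skein (i : ℕ) (h : 1 ≤ i ∧ i < n) :
      Rel lam laminv del z q n (FG S n i - FGi S n i) (z • (FE S n i - 1))
  -- (7) untwisting relations
  | untwist_ge (i : ℕ) (h : 1 ≤ i ∧ i < n) :
      Rel lam laminv del z q n (FG S n i * FE S n i) (laminv • FE S n i)
  | untwist_eg (i : ℕ) (h : 1 ≤ i ∧ i < n) :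
      Rel lam laminv del z q n (FE S n i * FG S n i) (laminv • FE S n i)
  | untwist_ege_up (i : ℕ) (h : 1 ≤ i ∧ i + 1 < n) :
      Rel lam laminv del z q n (FE S n i * FG S n (i + 1) * FE S n i) (lam • FE S n i)
  | untwist_ege_down (i : ℕ) (h : 1 ≤ i ∧ i + 1 < n) :
      Rel lam laminv del z q n (FE S n (i + 1) * FG S n i * FE S n (i + 1))
        (lam • FE S n (i + 1))
  -- (8) unwrapping relations
  | unwrap_left (h : 1 < n) :
      Rel lam laminv del z q n (FE S n 1 * FX S n * FG S n 1 * FX S n) (laminv • FE S n 1)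
  | unwrap_right (h : 1 < n) :
      Rel lam laminv del z q n (FX S n * FG S n 1 * FX S n * FE S n 1) (laminv • FE S n 1)

/-- The affine Birman–Wenzl–Murakami algebra `Ŵ_{n,S}`, presented by
generators and relations. -/
abbrev Alg (lam laminv del z : S) (q : ℕ → S) (n : ℕ) : Type _ :=
  RingQuot (Rel S lam laminv del z q n)

variable (lam laminv del z : S) (q : ℕ → S) (n : ℕ)

/-- The generator `x₁` of `Ŵ_{n,S}`. -/
noncomputable def ax : Alg S lam laminv del z q n :=
  RingQuot.mkAlgHom S (Rel S lam laminv del z q n) (FX S n)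

/-- The generator `x₁⁻¹` of `Ŵ_{n,S}`. -/
noncomputable def axi : Alg S lam laminv del z q n :=
  RingQuot.mkAlgHom S (Rel S lam laminv del z q n) (FXi S n)

/-- The generator `g i` of `Ŵ_{n,S}`. -/
noncomputable def ag (i : ℕ) : Alg S lam laminv del z q n :=
  RingQuot.mkAlgHom S (Rel S lam laminv del z q n) (FG S n i)

/-- The generator `g i⁻¹` of `Ŵ_{n,S}`. -/
noncomputable def agi (i : ℕ) : Alg S lam laminv del z q n :=
  RingQuot.mkAlgHom S (Rel S lam laminv del z q n) (FGi S n i)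

/-- The generator `e i` of `Ŵ_{n,S}`. -/
noncomputable def ae (i : ℕ) : Alg S lam laminv del z q n :=
  RingQuot.mkAlgHom S (Rel S lam laminv del z q n) (FE S n i)

/-- The descending product `g_k ⋯ g_2 g_1`. -/
noncomputable def gdesc : ℕ → Alg S lam laminv del z q n
  | 0 => 1
  | k + 1 => ag S lam laminv del z q n (k + 1) * gdesc k

/-- The ascending product `g_1 g_2 ⋯ g_k`. -/
noncomputable def gasc : ℕ → Alg S lam laminv del z q n
  | 0 => 1
  | k + 1 => gasc k * ag S lam laminv del z q n (k + 1)

/-- The descending product `g_k⁻¹ ⋯ g_2⁻¹ g_1⁻¹`. -/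
noncomputable def gidesc : ℕ → Alg S lam laminv del z q n
  | 0 => 1
  | k + 1 => agi S lam laminv del z q n (k + 1) * gidesc k

/-- The ascending product `g_1⁻¹ g_2⁻¹ ⋯ g_k⁻¹`. -/
noncomputable def giasc : ℕ → Alg S lam laminv del z q n
  | 0 => 1
  | k + 1 => giasc k * agi S lam laminv del z q n (k + 1)

/-- The element `x_r = (g_{r-1} ⋯ g_1) x_1 (g_1 ⋯ g_{r-1})` (this gives `x_1` for `r = 1`). -/
noncomputable def xvar (r : ℕ) : Alg S lam laminv del z q n :=
  gdesc S lam laminv del z q n (r - 1) * ax S lam laminv del z q n *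
    gasc S lam laminv del z q n (r - 1)

/-- The element `x_r⁻¹ = (g_{r-1}⁻¹ ⋯ g_1⁻¹) x_1⁻¹ (g_1⁻¹ ⋯ g_{r-1}⁻¹)`. -/
noncomputable def xvarInv (r : ℕ) : Alg S lam laminv del z q n :=
  gidesc S lam laminv del z q n (r - 1) * axi S lam laminv del z q n *
    giasc S lam laminv del z q n (r - 1)

/-- The integer power `x_r^m`. -/
noncomputable def xzpow (r : ℕ) (m : ℤ) : Alg S lam laminv del z q n :=
  if 0 ≤ m then xvar S lam laminv del z q n r ^ m.toNat
  else xvarInv S lam laminv del z q n r ^ (-m).toNat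

end ABMW

namespace ABMW

section Monoid

variable {M : Type*} [Monoid M] {a b x xi y yi : M}

lemma conj_affine_braid (hab : a * b * a = b * a * b) (hbx : b * x = x * b)
    (hax : a * x * a * x = x * a * x * a) :
    b * (a * x * a) * b * (a * x * a) = (a * x * a) * b * (a * x * a) * b := by
  calc b * (a * x * a) * b * (a * x * a)
      = b * a * x * (a * b * a) * x * a := by simp only [mul_assoc]
    _ = b * a * (x * b) * a * (b * x) * a := by rw [hab]; simp only [mul_assoc]
    _ = (b * a * b) * x * a * x * b * a := by rw [← hbx, hbx]; simp only [mul_assoc, hbx]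
    _ = a * b * (a * x * a * x) * b * a := by rw [← hab]; simp only [mul_assoc]
    _ = a * (b * x) * a * x * (a * b * a) := by rw [hax]; simp only [mul_assoc]
    _ = a * x * b * a * (x * b) * a * b := by rw [hbx, hab]; simp only [mul_assoc]
    _ = a * x * (b * a * b) * x * a * b := by rw [← hbx]; simp only [mul_assoc]
    _ = (a * x * a) * b * (a * x * a) * b := by rw [← hab]; simp only [mul_assoc]

lemma mul_inv_sandwich (hx : x * xi = 1) (ha : a * b = 1) : (a * x * a) * (b * xi * b) = 1 := by
  calc (a * x * a) * (b * xi * b) = a * (x * (a * b) * xi) * b := by simp only [mul_assoc]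
    _ = 1 := by rw [ha, mul_one, hx, mul_one, ha]

/-- Two-sided inverses of commuting elements commute. -/
lemma inv_mul_inv_comm (hx : x * xi = 1) (hx' : xi * x = 1) (hy : y * yi = 1) (hy' : yi * y = 1)
    (h : x * y = y * x) : xi * yi = yi * xi := by
  let u : Mˣ := ⟨x, xi, hx, hx'⟩
  let v : Mˣ := ⟨y, yi, hy, hy'⟩
  have huv : Commute (u : M) v := h
  exact huv.units_inv_left.units_inv_right

end Monoid

section Algebra

variable {S A : Type*} [CommRing S] [Ring A] [Algebra S A] {lam laminv : S} {a b d e x xi y yi : A}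

lemma conj_unwrap (hab : a * b * a = b * a * b) (hbx : b * x = x * b)
    (heab : e * a * b = e * d) (hdx : d * x * a * x = laminv • d)
    (hdba : d * b * a = d * e) (hede : e * d * e = e) :
    e * (a * x * a) * b * (a * x * a) = laminv • e := by
  calc e * (a * x * a) * b * (a * x * a)
      = e * a * x * (a * b * a) * x * a := by simp only [mul_assoc]
    _ = e * a * (x * b) * a * (b * x) * a := by rw [hab]; simp only [mul_assoc]
    _ = (e * a * b) * x * a * x * b * a := by rw [← hbx, hbx]; simp only [mul_assoc, hbx]
    _ = e * (d * x * a * x) * b * a := by rw [heab]; simp only [mul_assoc]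
    _ = laminv • (e * (d * b * a)) := by
      rw [hdx]; simp only [mul_assoc, mul_smul_comm, smul_mul_assoc]
    _ = laminv • e := by rw [hdba, ← mul_assoc, hede]

/-- If `e x y = c e` and `y` commutes with `x`, then `e x^r y = c e x^(r-1)` for `r ≥ 1`. -/
lemma mul_pow_mul_of_comm {c : S} (hxy : x * y = y * x) (h : e * x * y = c • e)
    {r : ℕ} (hr : 1 ≤ r) : e * x ^ r * y = c • (e * x ^ (r - 1)) := by
  obtain ⟨k, rfl⟩ := Nat.exists_eq_add_of_le' hr
  have hk : x ^ k * y = y * x ^ k := (show Commute x y from hxy).pow_left k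
  rw [Nat.add_sub_cancel, pow_succ', ← smul_mul_assoc, ← h]
  simp only [mul_assoc, hk]

lemma mul_inv_mul_inv_of_comm (hlam : lam * laminv = 1) (hx : x * xi = 1) (hx' : xi * x = 1)
    (hy : y * yi = 1) (hy' : yi * y = 1) (hxy : x * y = y * x) (h : e * x * y = laminv • e) :
    e * xi * yi = lam • e := by
  have he : e = lam • (e * x * y) := by rw [h, smul_smul, hlam, one_smul]
  calc e * xi * yi = lam • (e * (x * y)) * xi * yi := by rw [← mul_assoc, ← he]
    _ = lam • (e * (x * y) * (xi * yi)) := by simp only [smul_mul_assoc, mul_assoc]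
    _ = lam • (e * (x * (y * yi) * xi)) := by
      rw [inv_mul_inv_comm hx hx' hy hy' hxy]; simp only [mul_assoc]
    _ = lam • e := by rw [hy, mul_one, hx, mul_one]

end Algebra

section Relations

variable {S : Type*} [CommRing S] {lam laminv del z : S} {q : ℕ → S} {N : ℕ}

local notation "G" => ag S lam laminv del z q N
local notation "Gi" => agi S lam laminv del z q N
local notation "E" => ae S lam laminv del z q N
local notation "X" => xvar S lam laminv del z q N
local notation "Xi" => xvarInv S lam laminv del z q N

lemma mkAlgHom_eq {a b : FreeAlgebra S (Gen N)} (h : Rel S lam laminv del z q N a b) :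
    RingQuot.mkAlgHom S (Rel S lam laminv del z q N) a =
      RingQuot.mkAlgHom S (Rel S lam laminv del z q N) b :=
  RingQuot.mkAlgHom_rel S h

lemma ag_mul_agi (i : ℕ) : G i * Gi i = 1 := by
  by_cases h : 1 ≤ i ∧ i < N
  · simpa [ag, agi] using mkAlgHom_eq (Rel.inv_right i h)
  · simp [ag, agi, FG, FGi, h]

lemma agi_mul_ag (i : ℕ) : Gi i * G i = 1 := by
  by_cases h : 1 ≤ i ∧ i < N
  · simpa [ag, agi] using mkAlgHom_eq (Rel.inv_left i h)
  · simp [ag, agi, FG, FGi, h]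

lemma ae_mul_ag {i : ℕ} (h : 1 ≤ i ∧ i < N) : E i * G i = laminv • E i := by
  simpa [ag, ae] using mkAlgHom_eq (Rel.untwist_eg i h)

lemma ag_braid {i : ℕ} (h : 1 ≤ i ∧ i + 1 < N) :
    G i * G (i + 1) * G i = G (i + 1) * G i * G (i + 1) := by
  simpa [ag] using mkAlgHom_eq (Rel.braid i h)

lemma xvar_one : X 1 = ax S lam laminv del z q N := by
  simp [xvar, gdesc, gasc]

lemma xvarInv_one : Xi 1 = axi S lam laminv del z q N := by
  simp [xvarInv, gidesc, giasc]

lemma xvar_succ {m : ℕ} (hm : 1 ≤ m) : X (m + 1) = G m * X m * G m := by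
  obtain ⟨k, rfl⟩ := Nat.exists_eq_add_of_le' hm
  simp [xvar, gdesc, gasc, mul_assoc]

lemma xvarInv_succ {m : ℕ} (hm : 1 ≤ m) : Xi (m + 1) = Gi m * Xi m * Gi m := by
  obtain ⟨k, rfl⟩ := Nat.exists_eq_add_of_le' hm
  simp [xvarInv, gidesc, giasc, mul_assoc]

lemma xvar_mul_xvarInv {m : ℕ} (hm : 1 ≤ m) : X m * Xi m = 1 := by
  induction m, hm using Nat.le_induction with
  | base => simpa [xvar_one, xvarInv_one, ax, axi] using mkAlgHom_eq Rel.xinv_right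
  | succ m hm ih =>
    rw [xvar_succ hm, xvarInv_succ hm]
    exact mul_inv_sandwich ih (ag_mul_agi m)

lemma xvarInv_mul_xvar {m : ℕ} (hm : 1 ≤ m) : Xi m * X m = 1 := by
  induction m, hm using Nat.le_induction with
  | base => simpa [xvar_one, xvarInv_one, ax, axi] using mkAlgHom_eq Rel.xinv_left
  | succ m hm ih =>
    rw [xvar_succ hm, xvarInv_succ hm]
    exact mul_inv_sandwich ih (agi_mul_ag m)

lemma commute_ag_xvar {m j : ℕ} (hm : 1 ≤ m) (hmj : m < j) (hj : j < N) :
    Commute (G j) (X m) := by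
  induction m, hm using Nat.le_induction with
  | base =>
    have h := mkAlgHom_eq (lam := lam) (laminv := laminv) (del := del) (z := z) (q := q)
      (Rel.comm_xg j ⟨hmj, hj⟩)
    simp only [map_mul] at h
    rw [xvar_one]
    exact h.symm
  | succ m hm ih =>
    have h := mkAlgHom_eq (lam := lam) (laminv := laminv) (del := del) (z := z) (q := q)
      (Rel.comm_gg j m ⟨by omega, hm, hj, by omega, by omega⟩)
    simp only [map_mul] at h
    have hg : Commute (G j) (G m) := h
    rw [xvar_succ hm]
    exact (hg.mul_right (ih (by omega))).mul_right hg

lemma ag_xvar_braid {m : ℕ} (hm : 1 ≤ m) (hmN : m < N) :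
    G m * X m * G m * X m = X m * G m * X m * G m := by
  induction m, hm using Nat.le_induction with
  | base => simpa [xvar_one, ag, ax] using (mkAlgHom_eq (Rel.xbraid hmN)).symm
  | succ m hm ih =>
    rw [xvar_succ hm]
    exact conj_affine_braid (ag_braid ⟨hm, hmN⟩) (commute_ag_xvar hm (by omega) hmN)
      (ih (by omega))

lemma ae_xvar_unwrap {m : ℕ} (hm : 1 ≤ m) (hmN : m < N) :
    E m * X m * G m * X m = laminv • E m := by
  induction m, hm using Nat.le_induction with
  | base => simpa [xvar_one, ae, ag, ax] using mkAlgHom_eq (Rel.unwrap_left hmN)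
  | succ m hm ih =>
    rw [xvar_succ hm]
    refine conj_unwrap (d := E m) (ag_braid ⟨hm, hmN⟩) (commute_ag_xvar hm (by omega) hmN) ?_
      (ih (by omega)) ?_ ?_
    · simpa [ae, ag] using mkAlgHom_eq (Rel.tangle_egg_down m ⟨hm, hmN⟩)
    · simpa [ae, ag] using mkAlgHom_eq (Rel.tangle_egg_up m ⟨hm, hmN⟩)
    · simpa [ae] using mkAlgHom_eq (Rel.tangle_eee_down m ⟨hm, hmN⟩)

lemma xvar_comm_ag_xvar_ag {m : ℕ} (hm : 1 ≤ m) (hmN : m < N) :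
    X m * (G m * X m * G m) = G m * X m * G m * X m := by
  simpa only [mul_assoc] using (ag_xvar_braid hm hmN).symm

lemma ae_xvar_mul_ag_xvar_ag {m : ℕ} (hm : 1 ≤ m) (hmN : m < N) :
    E m * X m * (G m * X m * G m) = laminv ^ 2 • E m := by
  simp only [← mul_assoc]
  rw [ae_xvar_unwrap hm hmN, smul_mul_assoc, ae_mul_ag ⟨hm, hmN⟩, smul_smul, sq]

lemma ae_xvar_pow_unwrap {m r : ℕ} (hm : 1 ≤ m) (hmN : m < N) (hr : 1 ≤ r) :
    E m * X m ^ r * G m * X m = laminv ^ 2 • (E m * X m ^ (r - 1) * Gi m) := by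
  have h := mul_pow_mul_of_comm (xvar_comm_ag_xvar_ag hm hmN)
    (ae_xvar_mul_ag_xvar_ag (S := S) (lam := lam) (laminv := laminv) (del := del) (z := z) (q := q)
      hm hmN) hr
  rw [← smul_mul_assoc, ← h]
  simp only [mul_assoc, ag_mul_agi, mul_one]

lemma ae_xvarInv_pow_unwrap (hlam : lam * laminv = 1) {m r : ℕ} (hm : 1 ≤ m) (hmN : m < N)
    (hr : 1 ≤ r) :
    E m * Xi m ^ r * Gi m * Xi m = lam ^ 2 • (E m * Xi m ^ (r - 1) * G m) := by
  have hx := xvar_mul_xvarInv (lam := lam) (laminv := laminv) (del := del) (z := z) (q := q)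
    (N := N) hm
  have hx' := xvarInv_mul_xvar (lam := lam) (laminv := laminv) (del := del) (z := z) (q := q)
    (N := N) hm
  have hy := mul_inv_sandwich hx (ag_mul_agi m)
  have hy' := mul_inv_sandwich hx' (agi_mul_ag m)
  have hxy := xvar_comm_ag_xvar_ag (lam := lam) (laminv := laminv) (del := del) (z := z) (q := q)
    hm hmN
  have hlam2 : lam ^ 2 * laminv ^ 2 = 1 := by rw [← mul_pow, hlam, one_pow]
  have h := mul_pow_mul_of_comm (inv_mul_inv_comm hx hx' hy hy' hxy)
    (mul_inv_mul_inv_of_comm hlam2 hx hx' hy hy' hxy (ae_xvar_mul_ag_xvar_ag hm hmN)) hr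
  rw [← smul_mul_assoc, ← h]
  simp only [mul_assoc, agi_mul_ag, mul_one]

end Relations

/-- In `Ŵ_{n+1,S}`, for every `n ≥ 1` and every integer `r ≥ 1`:
(1) `g_n x_n g_n x_n = x_n g_n x_n g_n`;
(2) `e_n x_n g_n x_n = λ⁻¹ e_n`;
(3) `e_n x_n^r g_n x_n = λ⁻² e_n x_n^{r-1} g_n⁻¹`;
(4) `e_n x_n^{-r} g_n⁻¹ x_n⁻¹ = λ² e_n x_n^{-r+1} g_n`. -/
theorem unwrapping_and_affine_braid
    (S : Type*) [CommRing S] (lam laminv del delinv z : S) (q : ℕ → S)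
    (hlam : lam * laminv = 1) (hdel : del * delinv = 1)
    (hskein : laminv - lam = z * (del - 1)) (n : ℕ) (hn : 1 ≤ n)
    (r : ℕ) (hr : 1 ≤ r) :
    (ag S lam laminv del z q (n + 1) n * xvar S lam laminv del z q (n + 1) n *
        ag S lam laminv del z q (n + 1) n * xvar S lam laminv del z q (n + 1) n =
      xvar S lam laminv del z q (n + 1) n * ag S lam laminv del z q (n + 1) n *
        xvar S lam laminv del z q (n + 1) n * ag S lam laminv del z q (n + 1) n) ∧
    (ae S lam laminv del z q (n + 1) n * xvar S lam laminv del z q (n + 1) n *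
        ag S lam laminv del z q (n + 1) n * xvar S lam laminv del z q (n + 1) n =
      laminv • ae S lam laminv del z q (n + 1) n) ∧
    (ae S lam laminv del z q (n + 1) n * xvar S lam laminv del z q (n + 1) n ^ r *
        ag S lam laminv del z q (n + 1) n * xvar S lam laminv del z q (n + 1) n =
      (laminv ^ 2) • (ae S lam laminv del z q (n + 1) n *
        xvar S lam laminv del z q (n + 1) n ^ (r - 1) * agi S lam laminv del z q (n + 1) n)) ∧
    (ae S lam laminv del z q (n + 1) n * xvarInv S lam laminv del z q (n + 1) n ^ r *
        agi S lam laminv del z q (n + 1) n * xvarInv S lam laminv del z q (n + 1) n =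
      (lam ^ 2) • (ae S lam laminv del z q (n + 1) n *
        xvarInv S lam laminv del z q (n + 1) n ^ (r - 1) *
          ag S lam laminv del z q (n + 1) n)) := by
  have hN : n < n + 1 := n.lt_succ_self
  exact ⟨ag_xvar_braid hn hN, ae_xvar_unwrap hn hN, ae_xvar_pow_unwrap hn hN hr,
    ae_xvarInv_pow_unwrap hlam hn hN hr⟩

end ABMW
end
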